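/- Suppose E[ν ln(ν)] = ∞. Then for GW-almost every tree 𝒯, for UNIF-almost every ray r ∈ S(𝒯), the Hölder exponent Hö(UNIF)(r) := liminf_{n→∞} (−1/n) ln(UNIF({r' ∈ S(𝒯) : r'_n = r_n})) equals 0. -/

import Mathlib

open MeasureTheory Filter Set

noncomputable section

/-- A configuration assigns to each Ulam–Harris label (a finite word on `ℕ`)
a number of children. A Galton–Watson tree is encoded by such a configuration. -/
abbrev Config : Type := List ℕ → ℕ

/-- `v` is a vertex of the tree encoded by the configuration `ω`:
every step of the path from the root is the index of a child of the previous vertex. -/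
def memTree (ω : Config) (v : List ℕ) : Prop :=
  ∀ k, (h : k < v.length) → v.get ⟨k, h⟩ < ω (v.take k)

/-- `Z ω u k` is the number of descendants of the vertex `u` at height `|u| + k`
in the tree encoded by `ω`. -/
def Z (ω : Config) (u : List ℕ) (k : ℕ) : ℕ :=
  Nat.card {v : List ℕ // v.length = k ∧ memTree ω (u ++ v)}

/-- `GW` is the law of the Galton–Watson tree with offspring distribution `q`:
under `GW` the numbers of children attached to the distinct labels
are i.i.d. with distribution `q`. -/
def IsGW (q : ℕ → ℝ) (GW : Measure Config) : Prop :=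
  IsProbabilityMeasure GW ∧
    ∀ (S : Finset (List ℕ)) (g : List ℕ → ℕ),
      GW {ω | ∀ u ∈ S, ω u = g u} = ∏ u ∈ S, ENNReal.ofReal (q (g u))

/-- The probability generating function `φ_n(x) = E[x^{Z_n}]` of the population
at height `n` under the measure `GW`. -/
def pgf (GW : Measure Config) (n : ℕ) (x : ℝ) : ℝ :=
  ∫ ω, x ^ (Z ω [] n) ∂GW

/-- The vertex at height `n` of the ray whose successive child choices are given by `ξ`. -/
def rayVertex (ξ : ℕ → ℕ) (n : ℕ) : List ℕ := List.ofFn (fun i : Fin n => ξ i)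


/-! ### Shifts -/

def sh (i : ℕ) (ω : Config) : Config := fun w => ω (i :: w)

def shv (u : List ℕ) (ω : Config) : Config := fun w => ω (u ++ w)

lemma sh_shv (u : List ℕ) (i : ℕ) (ω : Config) : sh i (shv u ω) = shv (u ++ [i]) ω := by
  funext w; simp [sh, shv]

lemma measurable_sh (i : ℕ) : Measurable (sh i) := by
  refine measurable_pi_lambda _ fun w => measurable_pi_apply _

lemma memTree_nil (ω : Config) : memTree ω [] := by
  intro k h; simp at h

lemma memTree_cons (ω : Config) (i : ℕ) (v : List ℕ) :
    memTree ω (i :: v) ↔ i < ω [] ∧ memTree (sh i ω) v := by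
  constructor
  · intro h
    refine ⟨by simpa using h 0 (by simp), fun k hk => ?_⟩
    simpa [sh] using h (k+1) (by simpa using hk)
  · rintro ⟨h0, h⟩ k hk
    cases k with
    | zero => simpa using h0
    | succ k => simpa [sh] using h k (by simpa using hk)

lemma memTree_append (ω : Config) (u v : List ℕ) :
    memTree ω (u ++ v) ↔ memTree ω u ∧ memTree (shv u ω) v := by
  induction u generalizing ω with
  | nil => simp [memTree_nil]; rfl
  | cons i u ih =>
    rw [List.cons_append, memTree_cons, memTree_cons, ih, and_assoc]; rfl

lemma memTree_snoc (ω : Config) (u : List ℕ) (i : ℕ) :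
    memTree ω (u ++ [i]) ↔ memTree ω u ∧ i < ω u := by
  rw [memTree_append, memTree_cons]; simp [memTree_nil, shv]

lemma Z_shv (ω : Config) (u : List ℕ) (hu : memTree ω u) (k : ℕ) :
    Z ω u k = Z (shv u ω) [] k := by
  unfold Z
  simp [memTree_append, hu]

def genEquiv (ω : Config) (k : ℕ) :
    {v : List ℕ // v.length = k + 1 ∧ memTree ω ([] ++ v)} ≃
      (Σ i : Fin (ω []), {v : List ℕ // v.length = k ∧ memTree (sh i ω) ([] ++ v)}) where
  toFun v := match v with
    | ⟨[], h⟩ => absurd h.1 (by simp)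
    | ⟨i :: w, h⟩ => ⟨⟨i, ((memTree_cons _ _ _).1 h.2).1⟩, ⟨w, by simpa using h.1,
        ((memTree_cons _ _ _).1 h.2).2⟩⟩
  invFun x := ⟨x.1 :: x.2.1, by simp [x.2.2.1], (memTree_cons _ _ _).2 ⟨x.1.2, x.2.2.2⟩⟩
  left_inv v := by
    rcases v with ⟨_ | ⟨i, w⟩, h⟩
    · simp at h
    · rfl
  right_inv x := rfl

lemma finite_gen (k : ℕ) : ∀ ω : Config,
    Finite {v : List ℕ // v.length = k ∧ memTree ω ([] ++ v)} := by
  induction k with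
  | zero =>
    intro ω
    have : Subsingleton {v : List ℕ // v.length = 0 ∧ memTree ω ([] ++ v)} := by
      constructor
      rintro ⟨a, ha, _⟩ ⟨b, hb, _⟩
      simp only [List.length_eq_zero_iff] at ha hb
      simp [ha, hb]
    infer_instance
  | succ k ih =>
    intro ω
    have := fun i : Fin (ω []) => ih (sh i ω)
    exact Finite.of_equiv _ (genEquiv ω k).symm

lemma Z_zero (ω : Config) : Z ω [] 0 = 1 := by
  unfold Z
  rw [Nat.card_eq_one_iff_unique]
  refine ⟨⟨?_⟩, ⟨⟨[], rfl, memTree_nil _⟩⟩⟩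
  rintro ⟨a, ha, _⟩ ⟨b, hb, _⟩
  simp only [List.length_eq_zero_iff] at ha hb
  simp [ha, hb]

lemma Z_succ (ω : Config) (k : ℕ) :
    Z ω [] (k + 1) = ∑ i ∈ Finset.range (ω []), Z (sh i ω) [] k := by
  unfold Z
  rw [Nat.card_congr (genEquiv ω k)]
  have := fun i : Fin (ω []) => finite_gen k (sh i ω)
  rw [Nat.card_sigma, Finset.sum_range]

lemma Z_succ_vertex (ω : Config) (u : List ℕ) (hu : memTree ω u) (k : ℕ) :
    Z ω u (k + 1) = ∑ i ∈ Finset.range (ω u), Z ω (u ++ [i]) k := by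
  rw [Z_shv ω u hu, Z_succ]
  have : shv u ω [] = ω u := by simp [shv]
  rw [this]
  refine Finset.sum_congr rfl fun i hi => ?_
  rw [Z_shv ω _ ((memTree_snoc _ _ _).2 ⟨hu, by simpa using hi⟩), sh_shv]

lemma measurable_root : Measurable (fun ω : Config => ω []) := measurable_pi_apply _

lemma measurableSet_lt_root (i : ℕ) : MeasurableSet {ω : Config | i < ω []} :=
  measurable_root (measurableSet_Ioi (a := i))

lemma measurable_Z (k : ℕ) : Measurable (fun ω : Config => Z ω [] k) := by
  induction k with
  | zero => simp only [Z_zero]; exact measurable_const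
  | succ k ih =>
    have h : Measurable (fun p : ℕ × Config => ∑ i ∈ Finset.range p.1, Z (sh i p.2) [] k) :=
      measurable_from_prod_countable_right fun n =>
        Finset.measurable_sum (Finset.range n) fun i _ => ih.comp (measurable_sh i)
    have h2 := h.comp (measurable_root.prodMk measurable_id)
    convert h2 using 1
    funext ω
    simp [Z_succ]

/-! ### Uniqueness of the law -/

def cyl (S : Finset (List ℕ)) (g : List ℕ → ℕ) : Set Config := {ω | ∀ u ∈ S, ω u = g u}

lemma measurableSet_cyl (S : Finset (List ℕ)) (g : List ℕ → ℕ) : MeasurableSet (cyl S g) := by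
  have : cyl S g = ⋂ u ∈ S, (fun ω : Config => ω u) ⁻¹' {g u} := by
    ext ω; simp [cyl]
  rw [this]
  exact Finset.measurableSet_biInter _ fun u _ => measurable_pi_apply u (measurableSet_singleton _)

lemma gw_unique {q : ℕ → ℝ} {μ ν : Measure Config} (hμ : IsGW q μ) (hν : IsGW q ν) : μ = ν := by
  have := hμ.1
  have := hν.1
  refine ext_of_generate_finite {s | ∃ S g, s = cyl S g ∨ s = ∅} ?_ ?_ ?_ ?_
  · apply le_antisymm
    · refine iSup_le fun u => ?_
      rintro s ⟨t, -, rfl⟩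
      have : (fun ω : Config => ω u) ⁻¹' t = ⋃ n ∈ t, cyl {u} (fun _ => n) := by
        ext ω; simp [cyl]
      rw [this]
      refine MeasurableSet.biUnion (Set.to_countable _) fun n _ => ?_
      exact MeasurableSpace.measurableSet_generateFrom ⟨_, _, Or.inl rfl⟩
    · refine MeasurableSpace.generateFrom_le ?_
      rintro s ⟨S, g, rfl | rfl⟩
      · exact measurableSet_cyl S g
      · exact MeasurableSet.empty
  · rintro s ⟨S, g, rfl | rfl⟩ t ⟨S', g', rfl | rfl⟩ hne
    · obtain ⟨ω, h1, h2⟩ := hne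
      refine ⟨S ∪ S', ω, Or.inl ?_⟩
      ext ω'
      simp only [cyl, Set.mem_inter_iff, Set.mem_ofPred_eq, Finset.mem_union]
      constructor
      · rintro ⟨a, b⟩ u (hu | hu)
        · rw [a u hu, h1 u hu]
        · rw [b u hu, h2 u hu]
      · intro h
        exact ⟨fun u hu => by rw [h u (Or.inl hu), h1 u hu],
          fun u hu => by rw [h u (Or.inr hu), h2 u hu]⟩
    all_goals simp at hne
  · rintro s ⟨S, g, rfl | rfl⟩
    · exact (hμ.2 S g).trans (hν.2 S g).symm
    · simp
  · simp

/-! ### Grafting -/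

def graft (i : ℕ) (p : Config × Config) : Config := fun v => match v with
  | [] => p.2 []
  | j :: w => if j = i then p.1 w else p.2 (Equiv.swap 0 i j :: w)

lemma graft_nil (i : ℕ) (p : Config × Config) : graft i p [] = p.2 [] := rfl

lemma sh_graft_self (i : ℕ) (p : Config × Config) : sh i (graft i p) = p.1 := by
  funext w; simp [sh, graft]

lemma sh_graft_ne (i j : ℕ) (h : j ≠ i) (p : Config × Config) :
    sh j (graft i p) = sh (Equiv.swap 0 i j) p.2 := by
  funext w; simp [sh, graft, h]

lemma measurable_graft (i : ℕ) : Measurable (graft i) := by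
  refine measurable_pi_lambda _ fun v => ?_
  cases v with
  | nil => exact (measurable_pi_apply _).comp measurable_snd
  | cons j w =>
    by_cases h : j = i
    · simp only [graft, h, if_true]; exact (measurable_pi_apply _).comp measurable_fst
    · simp only [graft, h, if_false]; exact (measurable_pi_apply _).comp measurable_snd

def relbl (i : ℕ) : List ℕ → List ℕ
  | [] => []
  | j :: w => Equiv.swap 0 i j :: w

lemma relbl_relbl (i : ℕ) (v : List ℕ) : relbl i (relbl i v) = v := by
  cases v <;> simp [relbl]

lemma isGW_graft {q : ℕ → ℝ} {μ : Measure Config} (hμ : IsGW q μ) (i : ℕ) :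
    IsGW q ((μ.prod μ).map (graft i)) := by
  have := hμ.1
  refine ⟨Measure.isProbabilityMeasure_map (measurable_graft i).aemeasurable, fun S g => ?_⟩
  have hm := measurableSet_cyl S g
  change (μ.prod μ).map (graft i) (cyl S g) = _
  rw [Measure.map_apply (measurable_graft i) hm]
  classical
  set S1 := (S.filter (fun v => v.head? = some i)).image List.tail with hS1
  set S2 := (S.filter (fun v => ¬ v.head? = some i)).image (relbl i) with hS2
  have key : graft i ⁻¹' (cyl S g) = (cyl S1 (fun w => g (i :: w))) ×ˢ
      (cyl S2 (fun v => g (relbl i v))) := by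
    ext ⟨T, ω⟩
    simp only [cyl, Set.mem_preimage, Set.mem_ofPred_eq, Set.mem_prod, hS1, hS2, Finset.mem_image,
      Finset.mem_filter, forall_exists_index, and_imp]
    constructor
    · intro h
      constructor
      · rintro w (_ | ⟨j, v⟩) hv hj rfl
        · simp at hj
        · simp only [List.head?_cons, Option.some.injEq] at hj
          subst hj
          simpa [graft] using h _ hv
      · rintro w (_ | ⟨j, v⟩) hv hj rfl
        · simpa [graft, relbl] using h _ hv
        · simp only [List.head?_cons, Option.some.injEq] at hj
          rw [relbl_relbl, ← h _ hv]
          simp [graft, hj, relbl]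
    · rintro ⟨h1, h2⟩ (_ | ⟨j, v⟩) hv
      · simpa [graft, relbl] using h2 _ [] hv (by simp) rfl
      · by_cases hj : j = i
        · subst hj
          simpa [graft] using h1 _ _ hv (by simp) rfl
        · have := h2 _ _ hv (by simpa using hj) rfl
          rw [relbl_relbl] at this
          rw [← this]
          simp [graft, hj, relbl]
  rw [key, Measure.prod_prod]
  have e1 := hμ.2 S1 (fun w => g (i :: w))
  have e2 := hμ.2 S2 (fun v => g (relbl i v))
  rw [show μ (cyl S1 _) = _ from e1, show μ (cyl S2 _) = _ from e2, hS1, hS2,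
    Finset.prod_image, Finset.prod_image,
    ← Finset.prod_filter_mul_prod_filter_not S (fun v => v.head? = some i)]
  · congr 1
    · refine Finset.prod_congr rfl fun v hv => ?_
      rcases v with _ | ⟨j, v⟩
      · simp at hv
      · simp only [Finset.mem_filter, List.head?_cons, Option.some.injEq] at hv
        simp [hv.2]
    · refine Finset.prod_congr rfl fun v hv => ?_
      rw [relbl_relbl]
  · intro a _ b _ h
    have := congrArg (relbl i) h
    simpa [relbl_relbl] using this
  · rintro (_ | ⟨a, v⟩) hv (_ | ⟨b, w⟩) hw h
    · rfl
    · simp at hv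
    · simp at hw
    · simp only [Finset.coe_filter, Set.mem_ofPred_eq, List.head?_cons, Option.some.injEq] at hv hw
      simp at h
      simp [hv.2, hw.2, h]

lemma map_graft {q : ℕ → ℝ} {μ : Measure Config} (hμ : IsGW q μ) (i : ℕ) :
    (μ.prod μ).map (graft i) = μ := gw_unique (isGW_graft hμ i) hμ

lemma lintegral_graft {q : ℕ → ℝ} {μ : Measure Config} (hμ : IsGW q μ) (i : ℕ)
    {f : Config → ENNReal} (hf : Measurable f) :
    ∫⁻ ω, f ω ∂μ = ∫⁻ T, ∫⁻ ω, f (graft i (T, ω)) ∂μ ∂μ := by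
  have := hμ.1
  conv_lhs => rw [← map_graft hμ i]
  rw [lintegral_map hf (measurable_graft i),
    lintegral_prod (fun a => f (graft i a)) (hf.comp (measurable_graft i)).aemeasurable]

lemma root_prob {q : ℕ → ℝ} {μ : Measure Config} (hμ : IsGW q μ) (l : ℕ) :
    μ {ω | ω [] = l} = ENNReal.ofReal (q l) := by
  simpa using hμ.2 {[]} (fun _ => l)


/-! ### Sibling sums and the spine operators -/

open Classical in
def sib (W : Config → ENNReal) (i : ℕ) (ω : Config) : ENNReal :=
  ∑' j, if j < ω [] ∧ j ≠ i then W (sh j ω) else 0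

lemma measurable_sib {W : Config → ENNReal} (hW : Measurable W) (i : ℕ) :
    Measurable (sib W i) := by
  unfold sib
  refine Measurable.tsum fun j => ?_
  refine Measurable.ite ?_ (hW.comp (measurable_sh j)) measurable_const
  exact (measurableSet_lt_root j).inter (MeasurableSet.const _)

lemma sib_graft (W : Config → ENNReal) (i : ℕ) (T ω : Config) (hi : i < ω []) :
    sib W i (graft i (T, ω)) = sib W 0 ω := by
  unfold sib
  rw [← Equiv.tsum_eq (Equiv.swap 0 i)]
  refine tsum_congr fun k => ?_
  rw [graft_nil]
  have h1 : (Equiv.swap 0 i k < ω [] ∧ Equiv.swap 0 i k ≠ i) ↔ (k < ω [] ∧ k ≠ 0) := by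
    rcases eq_or_ne k 0 with rfl | h0
    · simp
    · rcases eq_or_ne k i with rfl | hki
      · simp [h0, hi]; omega
      · rw [Equiv.swap_apply_of_ne_of_ne h0 hki]; simp [h0, hki]
  by_cases h : k < ω [] ∧ k ≠ 0
  · rw [if_pos h, if_pos (h1.2 h), sh_graft_ne _ _ (h1.2 h).2]
    simp
  · rw [if_neg h, if_neg (fun h' => h (h1.1 h'))]

open Classical in
def PP (W : Config → ENNReal) (t : ENNReal) : ℕ → (ℕ → Set ENNReal) → Config → ENNReal
  | 0, _, ω => W ω
  | n + 1, A, ω => ∑' i, if i < ω [] ∧ sib W i ω ∈ A 0 then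
      t * PP W t n (fun k => A (k + 1)) (sh i ω) else 0

lemma measurable_PP {W : Config → ENNReal} (hW : Measurable W) (t : ENNReal) (n : ℕ) :
    ∀ (A : ℕ → Set ENNReal), (∀ k, MeasurableSet (A k)) → Measurable (PP W t n A) := by
  induction n with
  | zero => intro A hA; exact hW
  | succ n ih =>
    intro A hA
    change Measurable (fun ω => PP W t (n + 1) A ω)
    simp only [PP]
    refine Measurable.tsum fun i => ?_
    refine Measurable.ite ?_ ?_ measurable_const
    · exact (measurableSet_lt_root i).inter (measurable_sib hW i (hA 0))
    · exact ((ih _ fun k => hA (k + 1)).comp (measurable_sh i)).const_mul t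

open Classical in
def TopO (μ : Measure Config) (W : Config → ENNReal) (t : ENNReal) (A : Set ENNReal)
    (F : ENNReal → ENNReal) (x : ENNReal) : ENNReal :=
  ∫⁻ ω, (if sib W 0 ω ∈ A then F (t * (x + sib W 0 ω)) else 0) * (t * (ω [] : ENNReal)) ∂μ

lemma measurable_rootE : Measurable (fun ω : Config => (ω [] : ENNReal)) :=
  (measurable_of_countable (fun n : ℕ => (n : ENNReal))).comp measurable_root

lemma measurable_top_integrand {W : Config → ENNReal} (hW : Measurable W) (t : ENNReal)
    {A : Set ENNReal} (hA : MeasurableSet A) {F : ENNReal → ENNReal} (hF : Measurable F) :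
    Measurable (fun p : ENNReal × Config => (open Classical in
      if sib W 0 p.2 ∈ A then F (t * (p.1 + sib W 0 p.2)) else 0) * (t * (p.2 [] : ENNReal))) := by
  have hs : Measurable (fun p : ENNReal × Config => sib W 0 p.2) :=
    (measurable_sib hW 0).comp measurable_snd
  refine Measurable.mul ?_ ?_
  · refine Measurable.ite (hs hA) ?_ measurable_const
    exact hF.comp ((measurable_fst.add hs).const_mul t)
  · exact (measurable_rootE.comp measurable_snd).const_mul t

lemma measurable_TopO {μ : Measure Config} [SFinite μ] {W : Config → ENNReal} (hW : Measurable W)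
    (t : ENNReal)
    {A : Set ENNReal} (hA : MeasurableSet A) {F : ENNReal → ENNReal} (hF : Measurable F) :
    Measurable (TopO μ W t A F) := by
  unfold TopO
  exact (measurable_top_integrand hW t hA hF).lintegral_prod_right'

lemma tsum_lt_const (n : ℕ) (c : ENNReal) : (∑' i : ℕ, if i < n then c else 0) = n * c := by
  rw [tsum_eq_sum (s := Finset.range n)]
  · rw [Finset.sum_congr rfl (g := fun _ => c)]
    · simp
    · intro i hi; simp at hi; simp [hi]
  · intro i hi; simp at hi; simp [hi]

lemma one_step {q : ℕ → ℝ} {μ : Measure Config} (hμ : IsGW q μ) {W : Config → ENNReal}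
    (hW : Measurable W) (t : ENNReal)
    (hWt : ∀ᵐ ω ∂μ, ∀ i < ω [], W ω = t * (W (sh i ω) + sib W i ω))
    {A : Set ENNReal} (hA : MeasurableSet A) {F : ENNReal → ENNReal} (hF : Measurable F)
    {H : Config → ENNReal} (hH : Measurable H) :
    ∫⁻ ω, (open Classical in ∑' i, if i < ω [] ∧ sib W i ω ∈ A then
      t * H (sh i ω) else 0) * F (W ω) ∂μ = ∫⁻ T, H T * TopO μ W t A F (W T) ∂μ := by
  classical
  have := hμ.1
  set φ : ℕ → Config → ENNReal := fun i ω => if i < ω [] ∧ sib W i ω ∈ A then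
      t * H (sh i ω) * F (t * (W (sh i ω) + sib W i ω)) else 0 with hφ
  have hφm : ∀ i, Measurable (φ i) := by
    intro i
    refine Measurable.ite ?_ ?_ measurable_const
    · exact (measurableSet_lt_root i).inter (measurable_sib hW i hA)
    · refine ((hH.comp (measurable_sh i)).const_mul t).mul (hF.comp ?_)
      exact ((hW.comp (measurable_sh i)).add (measurable_sib hW i)).const_mul t
  have h1 : ∫⁻ ω, (∑' i, if i < ω [] ∧ sib W i ω ∈ A then
      t * H (sh i ω) else 0) * F (W ω) ∂μ = ∫⁻ ω, ∑' i, φ i ω ∂μ := by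
    refine lintegral_congr_ae ?_
    filter_upwards [hWt] with ω hω
    rw [← ENNReal.tsum_mul_right]
    refine tsum_congr fun i => ?_
    simp only [hφ]
    split_ifs with h
    · rw [← hω i h.1]
    · simp
  have h2 : ∀ i, ∫⁻ ω, φ i ω ∂μ = ∫⁻ T, ∫⁻ ω, (if i < ω [] then (if sib W 0 ω ∈ A then
      t * H T * F (t * (W T + sib W 0 ω)) else 0) else 0) ∂μ ∂μ := by
    intro i
    rw [lintegral_graft hμ i (hφm i)]
    refine lintegral_congr fun T => lintegral_congr fun ω => ?_
    simp only [hφ, graft_nil, sh_graft_self]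
    by_cases hi : i < ω []
    · simp only [sib_graft W i T ω hi, hi, true_and, if_true]
    · simp [hi]
  have hm3 : ∀ i, Measurable (fun p : Config × Config => if i < p.2 [] then
      (if sib W 0 p.2 ∈ A then t * H p.1 * F (t * (W p.1 + sib W 0 p.2)) else 0) else 0) := by
    intro i
    have hs : Measurable (fun p : Config × Config => sib W 0 p.2) :=
      (measurable_sib hW 0).comp measurable_snd
    refine Measurable.ite (measurable_snd (measurableSet_lt_root i)) ?_ measurable_const
    refine Measurable.ite (hs hA) ?_ measurable_const
    refine ((hH.comp measurable_fst).const_mul t).mul (hF.comp ?_)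
    exact ((hW.comp measurable_fst).add hs).const_mul t
  rw [h1, lintegral_tsum fun i => (hφm i).aemeasurable]
  simp_rw [h2]
  rw [← lintegral_tsum fun i => (hm3 i).lintegral_prod_right'.aemeasurable]
  refine lintegral_congr fun T => ?_
  refine (lintegral_tsum fun i =>
    ((hm3 i).comp (measurable_prodMk_left (x := T))).aemeasurable).symm.trans ?_
  unfold TopO
  refine Eq.trans ?_ (lintegral_const_mul (H T)
    ((measurable_top_integrand hW t hA hF).comp (measurable_prodMk_left (x := W T))))
  refine lintegral_congr fun ω => ?_
  simp only [Function.comp]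
  rw [tsum_lt_const]
  split_ifs <;> ring

def QQ (μ : Measure Config) (W : Config → ENNReal) (t : ENNReal) :
    ℕ → (ℕ → Set ENNReal) → (ENNReal → ENNReal) → ENNReal → ENNReal
  | 0, _, F => F
  | n + 1, A, F => QQ μ W t n (fun k => A (k + 1)) (TopO μ W t (A 0) F)

lemma measurable_QQ {μ : Measure Config} [SFinite μ] {W : Config → ENNReal} (hW : Measurable W)
    (t : ENNReal) (n : ℕ) : ∀ (A : ℕ → Set ENNReal) (_ : ∀ k, MeasurableSet (A k))
    (F : ENNReal → ENNReal) (_ : Measurable F), Measurable (QQ μ W t n A F) := by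
  induction n with
  | zero => intro A _ F hF; exact hF
  | succ n ih =>
    intro A hA F hF
    exact ih _ (fun k => hA (k + 1)) _ (measurable_TopO hW t (hA 0) hF)

lemma PP_QQ {q : ℕ → ℝ} {μ : Measure Config} (hμ : IsGW q μ) {W : Config → ENNReal}
    (hW : Measurable W) (t : ENNReal)
    (hWt : ∀ᵐ ω ∂μ, ∀ i < ω [], W ω = t * (W (sh i ω) + sib W i ω)) (n : ℕ) :
    ∀ (A : ℕ → Set ENNReal) (_ : ∀ k, MeasurableSet (A k))
    (F : ENNReal → ENNReal) (_ : Measurable F),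
    ∫⁻ ω, PP W t n A ω * F (W ω) ∂μ = ∫⁻ ω, W ω * QQ μ W t n A F (W ω) ∂μ := by
  have := hμ.1
  induction n with
  | zero => intro A _ F hF; rfl
  | succ n ih =>
    intro A hA F hF
    have h := one_step hμ hW t hWt (hA 0) hF (measurable_PP hW t n _ fun k => hA (k + 1))
    have h2 := ih (fun k => A (k + 1)) (fun k => hA (k + 1)) _ (measurable_TopO (μ := μ) hW t (hA 0) hF)
    exact h.trans h2

lemma invar {q : ℕ → ℝ} {μ : Measure Config} (hμ : IsGW q μ) {W : Config → ENNReal}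
    (hW : Measurable W) (t : ENNReal)
    (hWt : ∀ᵐ ω ∂μ, ∀ i < ω [], W ω = t * (W (sh i ω) + sib W i ω))
    (hWs : ∀ᵐ ω ∂μ, W ω = ∑' i, if i < ω [] then t * W (sh i ω) else 0) (n : ℕ) :
    ∀ (F : ENNReal → ENNReal) (_ : Measurable F),
    ∫⁻ ω, W ω * F (W ω) ∂μ = ∫⁻ ω, W ω * QQ μ W t n (fun _ => univ) F (W ω) ∂μ := by
  have := hμ.1
  induction n with
  | zero => intro F hF; rfl
  | succ n ih =>
    intro F hF
    have h := one_step hμ hW t hWt MeasurableSet.univ hF hW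
    have h2 := ih _ (measurable_TopO (μ := μ) hW t MeasurableSet.univ hF)
    refine Eq.trans ?_ (h.trans h2)
    refine lintegral_congr_ae ?_
    filter_upwards [hWs] with ω hω
    congr 1
    rw [hω]
    simp


/-! ### Order estimates -/

lemma TopO_mono (μ : Measure Config) (W : Config → ENNReal) (t : ENNReal) (A : Set ENNReal)
    {F G : ENNReal → ENNReal} (h : F ≤ G) : TopO μ W t A F ≤ TopO μ W t A G := by
  intro x
  unfold TopO
  refine lintegral_mono fun ω => ?_
  gcongr
  split_ifs
  · exact h _
  · exact le_rfl

lemma TopO_anti (μ : Measure Config) (W : Config → ENNReal) (t : ENNReal) (A : Set ENNReal)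
    {F : ENNReal → ENNReal} (h : Antitone F) : Antitone (TopO μ W t A F) := by
  intro x y hxy
  unfold TopO
  refine lintegral_mono fun ω => ?_
  dsimp only
  gcongr
  split_ifs
  · apply h; gcongr
  · exact le_rfl

lemma TopO_smul (μ : Measure Config) (W : Config → ENNReal) (t : ENNReal) (A : Set ENNReal)
    (F : ENNReal → ENNReal) (c : ENNReal) (hc : c ≠ ⊤) :
    TopO μ W t A (fun x => c * F x) = fun x => c * TopO μ W t A F x := by
  funext x
  unfold TopO
  rw [← lintegral_const_mul' _ _ hc]
  refine lintegral_congr fun ω => ?_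
  split_ifs <;> ring

lemma QQ_mono (μ : Measure Config) (W : Config → ENNReal) (t : ENNReal) (n : ℕ) :
    ∀ (A : ℕ → Set ENNReal) {F G : ENNReal → ENNReal}, F ≤ G → QQ μ W t n A F ≤ QQ μ W t n A G := by
  induction n with
  | zero => intro A F G h; exact h
  | succ n ih => intro A F G h; exact ih _ (TopO_mono μ W t _ h)

lemma QQ_smul (μ : Measure Config) (W : Config → ENNReal) (t : ENNReal) (n : ℕ) :
    ∀ (A : ℕ → Set ENNReal) (F : ENNReal → ENNReal) (c : ENNReal), c ≠ ⊤ →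
    QQ μ W t n A (fun x => c * F x) = fun x => c * QQ μ W t n A F x := by
  induction n with
  | zero => intro A F c h; rfl
  | succ n ih =>
    intro A F c h
    simp only [QQ]
    rw [TopO_smul _ _ _ _ _ _ h, ih _ _ _ h]

open Classical in
def pJ (μ : Measure Config) (W : Config → ENNReal) (t α β : ENNReal) : ENNReal :=
  ∫⁻ ω, (if α ≤ sib W 0 ω ∧ sib W 0 ω < β then 1 else 0) * (t * (ω [] : ENNReal)) ∂μ

lemma pJ_le_one (μ : Measure Config) (W : Config → ENNReal) (t α β : ENNReal)
    (ht : ∫⁻ ω, t * (ω [] : ENNReal) ∂μ ≤ 1) : pJ μ W t α β ≤ 1 := by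
  refine le_trans (lintegral_mono fun ω => ?_) ht
  split_ifs <;> simp

def Del (t : ENNReal) : ℕ → (ℕ → ENNReal) → ENNReal
  | 0, _ => 0
  | n + 1, β => t * (β 0 + Del t n (fun k => β (k + 1)))

lemma swap_one (μ : Measure Config) {W : Config → ENNReal} (hW : Measurable W) (t : ENNReal)
    (ht : ∫⁻ ω, t * (ω [] : ENNReal) ∂μ ≤ 1) (α β : ENNReal) {F : ENNReal → ENNReal}
    (hF : Antitone F) (D x : ENNReal) :
    (1 + pJ μ W t α β) * TopO μ W t (Set.Iio α) F (x - D) ≤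
      TopO μ W t univ (fun y => F (y - t * (β + D))) x := by
  classical
  have hx : x ≤ x - D + D := le_tsub_add
  have hFm : Measurable F := hF.measurable
  have hs := measurable_sib hW 0
  -- the bound by the value without jump
  have h1 : TopO μ W t (Set.Iio α) F (x - D) ≤ F (t * (x - D)) := by
    unfold TopO
    calc _ ≤ ∫⁻ ω, F (t * (x - D)) * (t * (ω [] : ENNReal)) ∂μ := by
          refine lintegral_mono fun ω => ?_
          dsimp only
          gcongr
          split_ifs
          · apply hF; gcongr; exact le_self_add
          · exact zero_le
      _ = F (t * (x - D)) * ∫⁻ ω, (t * (ω [] : ENNReal)) ∂μ :=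
          lintegral_const_mul _ (measurable_rootE.const_mul t)
      _ ≤ F (t * (x - D)) * 1 := by gcongr
      _ = _ := mul_one _
  have h2 : pJ μ W t α β * F (t * (x - D)) = ∫⁻ ω, F (t * (x - D)) *
      ((if α ≤ sib W 0 ω ∧ sib W 0 ω < β then 1 else 0) * (t * (ω [] : ENNReal))) ∂μ := by
    rw [mul_comm]
    refine (lintegral_const_mul _ ?_).symm
    refine Measurable.mul ?_ (measurable_rootE.const_mul t)
    exact Measurable.ite ((hs measurableSet_Ici).inter (hs measurableSet_Iio))
      measurable_const measurable_const
  calc (1 + pJ μ W t α β) * TopO μ W t (Set.Iio α) F (x - D)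
      = TopO μ W t (Set.Iio α) F (x - D) + pJ μ W t α β * TopO μ W t (Set.Iio α) F (x - D) := by
        ring
    _ ≤ TopO μ W t (Set.Iio α) F (x - D) + pJ μ W t α β * F (t * (x - D)) := by gcongr
    _ ≤ _ := by
      rw [h2]
      unfold TopO
      rw [← lintegral_add_left]
      · refine lintegral_mono fun ω => ?_
        dsimp only
        rw [← mul_assoc (F (t * (x - D))), ← add_mul]
        gcongr
        simp only [Set.mem_Iio, Set.mem_univ, if_true]
        by_cases hα : sib W 0 ω < α
        · rw [if_pos hα, if_neg (fun h => absurd hα (not_lt.2 h.1))]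
          simp only [mul_zero, add_zero]
          apply hF
          rw [tsub_le_iff_right, ← mul_add]
          refine mul_le_mul' le_rfl ?_
          calc x + sib W 0 ω ≤ x - D + D + sib W 0 ω := by gcongr
            _ ≤ x - D + D + sib W 0 ω + β := le_self_add
            _ = _ := by ring
        · rw [if_neg hα, zero_add]
          by_cases hβ : sib W 0 ω < β
          · rw [if_pos ⟨not_lt.1 hα, hβ⟩, mul_one]
            apply hF
            rw [tsub_le_iff_right, ← mul_add]
            refine mul_le_mul' le_rfl ?_
            calc x + sib W 0 ω ≤ x - D + D + β := by gcongr
              _ = _ := by ring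
          · rw [if_neg (fun h => hβ h.2)]; simp
      · exact (measurable_top_integrand hW t measurableSet_Iio hFm).comp
          (measurable_prodMk_left (x := x - D))

lemma swap_all (μ : Measure Config) {W : Config → ENNReal} (hW : Measurable W) (t : ENNReal)
    (ht : ∫⁻ ω, t * (ω [] : ENNReal) ∂μ ≤ 1) (n : ℕ) : ∀ (α β : ℕ → ENNReal)
    {F : ENNReal → ENNReal} (_ : Antitone F) (x : ENNReal),
    (∏ k ∈ Finset.range n, (1 + pJ μ W t (α k) (β k))) *
      QQ μ W t n (fun k => Set.Iio (α k)) F x ≤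
      QQ μ W t n (fun _ => univ) (fun y => F (y - Del t n β)) x := by
  induction n with
  | zero => intro α β F hF x; simp [QQ, Del]
  | succ n ih =>
    intro α β F hF x
    have hp : 1 + pJ μ W t (α 0) (β 0) ≠ ⊤ :=
      ENNReal.add_ne_top.2 ⟨by simp, ne_top_of_le_ne_top (by simp) (pJ_le_one μ W t _ _ ht)⟩
    rw [Finset.prod_range_succ', mul_comm _ (1 + _), mul_assoc]
    simp only [QQ]
    have h1 := ih (fun k => α (k + 1)) (fun k => β (k + 1))
      (TopO_anti μ W t (Set.Iio (α 0)) hF) x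
    calc _ ≤ (1 + pJ μ W t (α 0) (β 0)) * QQ μ W t n (fun _ => univ)
          (fun y => TopO μ W t (Set.Iio (α 0)) F (y - Del t n fun k => β (k + 1))) x := by gcongr
      _ = QQ μ W t n (fun _ => univ) (fun y => (1 + pJ μ W t (α 0) (β 0)) *
          TopO μ W t (Set.Iio (α 0)) F (y - Del t n fun k => β (k + 1))) x := by
          rw [QQ_smul _ _ _ _ _ _ _ hp]
      _ ≤ _ := by
          refine QQ_mono μ W t n _ (fun y => ?_) x
          exact swap_one μ hW t ht (α 0) (β 0) hF _ y

lemma main_bound {q : ℕ → ℝ} {μ : Measure Config} (hμ : IsGW q μ) {W : Config → ENNReal}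
    (hW : Measurable W) (t : ENNReal)
    (ht : ∫⁻ ω, t * (ω [] : ENNReal) ∂μ ≤ 1)
    (hWt : ∀ᵐ ω ∂μ, ∀ i < ω [], W ω = t * (W (sh i ω) + sib W i ω))
    (hWs : ∀ᵐ ω ∂μ, W ω = ∑' i, if i < ω [] then t * W (sh i ω) else 0) (n : ℕ)
    (α β : ℕ → ENNReal) (M : ENNReal) (hD : Del t n β ≤ M) :
    (∏ k ∈ Finset.range n, (1 + pJ μ W t (α k) (β k))) *
      ∫⁻ ω, PP W t n (fun k => Set.Iio (α k)) ω * (Set.Iic M).indicator 1 (W ω) ∂μ ≤ 2 * M := by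
  have := hμ.1
  have hind : ∀ M : ENNReal, Measurable ((Set.Iic M).indicator (1 : ENNReal → ENNReal)) :=
    fun M => measurable_one.indicator measurableSet_Iic
  have hanti : Antitone ((Set.Iic M).indicator (1 : ENNReal → ENNReal)) := by
    intro x y hxy
    by_cases hy : y ≤ M
    · simp [Set.indicator, hy, hxy.trans hy]
    · simp [Set.indicator, hy]
  rw [PP_QQ hμ hW t hWt n _ (fun k => measurableSet_Iio) _ (hind M)]
  have hmm : Measurable (fun ω => W ω * QQ μ W t n (fun k => Set.Iio (α k))
      ((Set.Iic M).indicator 1) (W ω)) :=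
    hW.mul ((measurable_QQ hW t n _ (fun k => measurableSet_Iio) _ (hind M)).comp hW)
  rw [← lintegral_const_mul _ hmm]
  calc _ ≤ ∫⁻ ω, W ω * QQ μ W t n (fun _ => univ) ((Set.Iic (2 * M)).indicator 1) (W ω) ∂μ := by
        refine lintegral_mono fun ω => ?_
        dsimp only
        rw [mul_left_comm]
        gcongr
        refine (swap_all μ hW t ht n α β hanti (W ω)).trans ?_
        refine QQ_mono μ W t n _ (fun y => ?_) _
        by_cases hy : y - Del t n β ≤ M
        · have : y ≤ 2 * M := by
            rw [two_mul]
            exact (tsub_le_iff_right.1 hy).trans (by gcongr)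
          simp [Set.indicator, hy, this]
        · simp [Set.indicator, hy]
    _ = ∫⁻ ω, W ω * (Set.Iic (2 * M)).indicator 1 (W ω) ∂μ :=
        (invar hμ hW t hWt hWs n _ (hind _)).symm
    _ ≤ ∫⁻ ω, 2 * M ∂μ := by
        refine lintegral_mono fun ω => ?_
        dsimp only
        by_cases hy : W ω ≤ 2 * M
        · simp [Set.indicator, hy]
        · simp [Set.indicator, hy]
    _ = 2 * M := by simp

/-- the surviving mass vanishes -/
lemma PP_zero {q : ℕ → ℝ} {μ : Measure Config} (hμ : IsGW q μ) {W : Config → ENNReal}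
    (hW : Measurable W) (t : ENNReal)
    (ht : ∫⁻ ω, t * (ω [] : ENNReal) ∂μ ≤ 1)
    (hWt : ∀ᵐ ω ∂μ, ∀ i < ω [], W ω = t * (W (sh i ω) + sib W i ω))
    (hWs : ∀ᵐ ω ∂μ, W ω = ∑' i, if i < ω [] then t * W (sh i ω) else 0)
    (hWf : ∀ᵐ ω ∂μ, W ω ≠ ⊤)
    (α β : ℕ → ENNReal) (M₀ : ENNReal) (hM₀ : M₀ ≠ ⊤) (hD : ∀ n, Del t n β ≤ M₀)
    (hp : ∑' k, pJ μ W t (α k) (β k) = ⊤) :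
    ∀ᵐ ω ∂μ, ⨅ n, PP W t n (fun k => Set.Iio (α k)) ω = 0 := by
  have key : ∀ N : ℕ, ∀ᵐ ω ∂μ, (⨅ n, PP W t n (fun k => Set.Iio (α k)) ω) *
      (Set.Iic (M₀ + N)).indicator 1 (W ω) = 0 := by
    intro N
    have hmeas : ∀ n, Measurable (PP W t n (fun k => Set.Iio (α k))) := fun n =>
      measurable_PP hW t n _ fun k => measurableSet_Iio
    have hm : Measurable (fun ω => (⨅ n, PP W t n (fun k => Set.Iio (α k)) ω) *
      (Set.Iic (M₀ + N)).indicator 1 (W ω)) :=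
      (Measurable.iInf hmeas).mul ((measurable_one.indicator measurableSet_Iic).comp hW)
    have : ∫⁻ ω, (⨅ n, PP W t n (fun k => Set.Iio (α k)) ω) *
      (Set.Iic (M₀ + N)).indicator 1 (W ω) ∂μ = 0 := by
      set I := ∫⁻ ω, (⨅ n, PP W t n (fun k => Set.Iio (α k)) ω) *
        (Set.Iic (M₀ + N)).indicator 1 (W ω) ∂μ with hI
      have hb : ∀ n, (∑ k ∈ Finset.range n, pJ μ W t (α k) (β k)) * I ≤ 2 * (M₀ + N) := by
        intro n
        refine le_trans ?_ (main_bound hμ hW t ht hWt hWs n α β (M₀ + N)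
          ((hD n).trans le_self_add))
        refine mul_le_mul' ?_ ?_
        · have : ∀ n, 1 + ∑ k ∈ Finset.range n, pJ μ W t (α k) (β k) ≤
              ∏ k ∈ Finset.range n, (1 + pJ μ W t (α k) (β k)) := by
            intro n
            induction n with
            | zero => simp
            | succ n ih =>
              rw [Finset.sum_range_succ, Finset.prod_range_succ, ← add_assoc, mul_add, mul_one]
              gcongr
              calc pJ μ W t (α n) (β n) = 1 * pJ μ W t (α n) (β n) := (one_mul _).symm
                _ ≤ _ := by gcongr; exact le_trans le_self_add ih
          exact le_trans le_add_self (this n)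
        · rw [hI]
          refine lintegral_mono fun ω => ?_
          dsimp only
          gcongr
          exact iInf_le (fun n => PP W t n (fun k => Set.Iio (α k)) ω) n
      by_contra hne
      have hlim : (∑' k, pJ μ W t (α k) (β k)) * I ≤ 2 * (M₀ + N) := by
        rw [← ENNReal.tsum_mul_right, ENNReal.tsum_eq_iSup_nat]
        refine iSup_le fun n => ?_
        rw [← Finset.sum_mul]
        exact hb n
      rw [hp, ENNReal.top_mul hne] at hlim
      have : 2 * (M₀ + (N : ENNReal)) ≠ ⊤ := by
        refine ENNReal.mul_ne_top (by simp) (ENNReal.add_ne_top.2 ⟨hM₀, by simp⟩)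
      exact this (top_le_iff.1 hlim)
    exact (lintegral_eq_zero_iff hm).1 this
  filter_upwards [ae_all_iff.2 key, hWf] with ω h hf
  obtain ⟨N, hN⟩ := ENNReal.exists_nat_gt hf
  have := h N
  have hle : W ω ≤ M₀ + N := hN.le.trans le_add_self
  simpa [Set.indicator, hle] using this


/-! ### Divergence of the jump probabilities -/

lemma prob_root_sub {q : ℕ → ℝ} {μ : Measure Config} (hμ : IsGW q μ) {B : Set Config}
    (hB : MeasurableSet B) (l j : ℕ) :
    μ {ω | ω [] = l ∧ sh j ω ∈ B} = μ B * ENNReal.ofReal (q l) := by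
  have := hμ.1
  have hm : MeasurableSet {ω : Config | ω [] = l ∧ sh j ω ∈ B} :=
    (measurable_root (measurableSet_singleton l)).inter (measurable_sh j hB)
  conv_lhs => rw [← map_graft hμ j]
  rw [Measure.map_apply (measurable_graft j) hm]
  have : graft j ⁻¹' {ω : Config | ω [] = l ∧ sh j ω ∈ B} = B ×ˢ {ω : Config | ω [] = l} := by
    ext ⟨T, ω⟩
    simp [graft_nil, sh_graft_self, and_comm]
  rw [this, Measure.prod_prod, root_prob hμ]

lemma exists_eta {μ : Measure Config} [IsProbabilityMeasure μ] {W : Config → ENNReal}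
    (hW : Measurable W) (hpos : ∀ᵐ ω ∂μ, W ω ≠ 0) :
    ∃ η : ℝ, 0 < η ∧ μ {ω | W ω < ENNReal.ofReal η} ≤ 1 / 4 := by
  have hlim := tendsto_measure_iInter_atTop (μ := μ)
    (s := fun n : ℕ => {ω | W ω < ENNReal.ofReal (1 / ((n : ℝ) + 1))})
    (fun n => (hW measurableSet_Iio).nullMeasurableSet)
    (fun a b hab ω hω => lt_of_lt_of_le hω (ENNReal.ofReal_le_ofReal (by gcongr)))
    ⟨0, measure_ne_top _ _⟩
  have h0 : μ (⋂ n : ℕ, {ω | W ω < ENNReal.ofReal (1 / ((n : ℝ) + 1))}) = 0 := by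
    refine measure_mono_null ?_ (ae_iff.1 hpos)
    intro ω hω
    simp only [Set.mem_iInter, Set.mem_ofPred_eq] at hω
    simp only [Set.mem_ofPred_eq, not_not]
    have h1 : Tendsto (fun n : ℕ => ENNReal.ofReal (1 / ((n : ℝ) + 1))) atTop (nhds 0) := by
      have := ENNReal.tendsto_ofReal (tendsto_one_div_add_atTop_nhds_zero_nat (𝕜 := ℝ))
      simpa using this
    exact le_antisymm (ge_of_tendsto' h1 fun n => (hω n).le) zero_le
  rw [h0] at hlim
  have := (hlim.eventually (gt_mem_nhds (show (0 : ENNReal) < 1 / 4 by simp))).exists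
  obtain ⟨n, hn⟩ := this
  exact ⟨1 / ((n : ℝ) + 1), by positivity, hn.le⟩

lemma prob_sib_large {q : ℕ → ℝ} {μ : Measure Config} (hμ : IsGW q μ) {W : Config → ENNReal}
    (hW : Measurable W) {η : ℝ} (hη : 0 < η) (hη4 : μ {ω | W ω < ENNReal.ofReal η} ≤ 1 / 4)
    (n : ℕ) :
    ENNReal.ofReal (q (n + 2)) / 2 ≤
      μ {ω | ω [] = n + 2 ∧ ENNReal.ofReal (η * (n + 1) / 2) ≤ sib W 0 ω} := by
  classical
  have := hμ.1
  set G := {ω : Config | ω [] = n + 2 ∧ ENNReal.ofReal (η * (n + 1) / 2) ≤ sib W 0 ω} with hG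
  set Bd := {ω : Config | ω [] = n + 2 ∧ sib W 0 ω < ENNReal.ofReal (η * (n + 1) / 2)} with hBd
  have hroot : MeasurableSet {ω : Config | ω [] = n + 2} :=
    measurable_root (measurableSet_singleton _)
  have hBdm : MeasurableSet Bd := hroot.inter (measurable_sib hW 0 measurableSet_Iio)
  let bs : ℕ → Set Config := fun j => {ω | ω [] = n + 2 ∧ sh (j+1) ω ∈ {ω | W ω < ENNReal.ofReal η}}
  have hbs : ∀ j, MeasurableSet (bs j) := fun j =>
    hroot.inter (measurable_sh (j+1) (hW measurableSet_Iio))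
  have hpt : ∀ ω, Bd.indicator (fun _ => ((n : ENNReal) + 1) / 2) ω ≤
      ∑ j ∈ Finset.range (n + 1), (bs j).indicator 1 ω := by
    intro ω
    by_cases hω : ω ∈ Bd
    swap
    · simp [hω]
    rw [Set.indicator_of_mem hω]
    set bad := (Finset.range (n + 1)).filter (fun j => W (sh (j+1) ω) < ENNReal.ofReal η) with hbad
    set good := (Finset.range (n + 1)).filter (fun j => ¬ W (sh (j+1) ω) < ENNReal.ofReal η)
      with hgood
    have hcard : bad.card + good.card = n + 1 := by
      rw [hbad, hgood, Finset.card_filter_add_card_filter_not]; simp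
    have hs1 : ∑ j ∈ Finset.range (n + 1), (bs j).indicator (1 : Config → ENNReal) ω = bad.card := by
      rw [hbad, Finset.card_filter]
      push_cast
      refine Finset.sum_congr rfl fun j _ => ?_
      simp [bs, Set.indicator, hω.1]
    have hs2 : (good.card : ENNReal) * ENNReal.ofReal η ≤ sib W 0 ω := by
      unfold sib
      calc (good.card : ENNReal) * ENNReal.ofReal η = ∑ j ∈ good, ENNReal.ofReal η := by simp
        _ ≤ ∑ j ∈ good, W (sh (j+1) ω) := by
            refine Finset.sum_le_sum fun j hj => ?_
            exact not_lt.1 (Finset.mem_filter.1 hj).2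
        _ = ∑ k ∈ good.map ⟨Nat.succ, Nat.succ_injective⟩, W (sh k ω) := by
            rw [Finset.sum_map]; rfl
        _ = ∑ k ∈ good.map ⟨Nat.succ, Nat.succ_injective⟩,
              if k < ω [] ∧ k ≠ 0 then W (sh k ω) else 0 := by
            refine Finset.sum_congr rfl fun k hk => ?_
            rw [if_pos]
            simp only [Finset.mem_map, Function.Embedding.coeFn_mk] at hk
            obtain ⟨j, hj, rfl⟩ := hk
            have := Finset.mem_range.1 (Finset.mem_filter.1 hj).1
            rw [hω.1]; omega
        _ ≤ _ := ENNReal.sum_le_tsum _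
    have hs3 := hs2.trans_lt hω.2
    rw [hs1]
    have hr : (good.card : ℝ) * η < η * (n + 1) / 2 := by
      rw [← ENNReal.ofReal_natCast, ← ENNReal.ofReal_mul (by positivity)] at hs3
      exact (ENNReal.ofReal_lt_ofReal_iff (by positivity)).1 hs3
    have hr2 : (good.card : ℝ) < (n + 1) / 2 := by
      by_contra hcon
      push Not at hcon
      nlinarith
    have hr3 : 2 * good.card < n + 1 := by
      have : (2 * good.card : ℝ) < n + 1 := by linarith
      exact_mod_cast this
    have hr4 : n + 1 ≤ bad.card * 2 := by omega
    rw [ENNReal.div_le_iff (by simp) (by simp)]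
    exact_mod_cast hr4
  have hint := lintegral_mono (μ := μ) hpt
  rw [lintegral_indicator_const hBdm, lintegral_finsetSum _
    (fun j _ => measurable_one.indicator (hbs j))] at hint
  have hj : ∀ j, ∫⁻ ω, (bs j).indicator 1 ω ∂μ ≤ 1 / 4 * ENNReal.ofReal (q (n + 2)) := by
    intro j
    have h := prob_root_sub hμ (B := {ω | W ω < ENNReal.ofReal η}) (hW measurableSet_Iio)
      (n + 2) (j + 1)
    rw [lintegral_indicator_one (hbs j), show μ (bs j) = _ from h]
    gcongr
  have hint2 := hint.trans (Finset.sum_le_sum fun j _ => hj j)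
  simp only [Finset.sum_const, Finset.card_range, nsmul_eq_mul] at hint2
  have hBq : μ Bd ≤ ENNReal.ofReal (q (n + 2)) / 2 := by
    have e : ENNReal.ofReal (q (n + 2)) / 2 =
        (((n : ENNReal) + 1) / 2)⁻¹ * (((n + 1 : ℕ) : ENNReal) * (1 / 4 * ENNReal.ofReal (q (n + 2)))) := by
      have : (((n : ENNReal) + 1) / 2)⁻¹ * (((n + 1 : ℕ) : ENNReal) * (1 / 4)) = 1 / 2 := by
        have hn : ((n : ENNReal) + 1) = ENNReal.ofReal ((n : ℝ) + 1) := by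
          rw [ENNReal.ofReal_add (by positivity) (by positivity)]; simp
        push_cast
        rw [hn, show (2 : ENNReal) = ENNReal.ofReal 2 by simp,
          show (1 / 4 : ENNReal) = ENNReal.ofReal (1/4) by
            rw [ENNReal.ofReal_div_of_pos (by norm_num)]; simp,
          show (1 : ENNReal) = ENNReal.ofReal 1 by simp,
          ← ENNReal.ofReal_div_of_pos (by norm_num), ← ENNReal.ofReal_div_of_pos (by norm_num),
          ← ENNReal.ofReal_inv_of_pos (by positivity), ← ENNReal.ofReal_mul (by positivity),
          ← ENNReal.ofReal_mul (by positivity)]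
        congr 1
        field_simp
        norm_num
      rw [← mul_assoc (((n + 1 : ℕ) : ENNReal)), ← mul_assoc, this]
      rw [one_div, mul_comm, div_eq_mul_inv]
    rw [e, mul_comm, ← div_eq_mul_inv, ENNReal.le_div_iff_mul_le, mul_comm]
    · exact hint2
    · left; simp
    · left; exact ENNReal.div_ne_top (by simp) (by simp)
  have hun : ENNReal.ofReal (q (n + 2)) ≤ μ G + μ Bd := by
    rw [← root_prob hμ]
    refine le_trans (measure_mono ?_) (measure_union_le _ _)
    intro ω hω
    rcases le_or_gt (ENNReal.ofReal (η * (n + 1) / 2)) (sib W 0 ω) with h | h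
    · exact Or.inl ⟨hω, h⟩
    · exact Or.inr ⟨hω, h⟩
  have h3 := hun.trans (add_le_add le_rfl hBq)
  have h4 : ENNReal.ofReal (q (n + 2)) / 2 + ENNReal.ofReal (q (n + 2)) / 2 ≤
      μ G + ENNReal.ofReal (q (n + 2)) / 2 := by rwa [ENNReal.add_halves]
  exact (ENNReal.add_le_add_iff_right (ENNReal.div_ne_top (by simp) (by simp))).1 h4

def alph (a : ℝ) (N k : ℕ) : ENNReal := if k < N then ⊤ else ENNReal.ofReal (a ^ k)

open Classical in
lemma count_lower {a b : ℝ} (ha : 1 < a) (hab : a < b) (N : ℕ) (S : ENNReal) (hS : S ≠ ⊤) {x : ℝ}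
    (hx : 0 < x) (hxS : ENNReal.ofReal x ≤ S) :
    ENNReal.ofReal ((1 / Real.log a - 1 / Real.log b) * Real.log x) ≤
      (∑' k, if alph a N k ≤ S ∧ S < ENNReal.ofReal (b ^ k) then (1 : ENNReal) else 0) +
        ((N + 1 : ℕ) : ENNReal) := by
  set s := S.toReal with hs
  have hSs : S = ENNReal.ofReal s := (ENNReal.ofReal_toReal hS).symm
  have hxs : x ≤ s := by
    rw [hSs] at hxS
    have := ENNReal.toReal_nonneg (a := S)
    exact (ENNReal.ofReal_le_ofReal_iff this).1 hxS
  have hs0 : 0 < s := hx.trans_le hxs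
  have hla : 0 < Real.log a := Real.log_pos ha
  have hlab : Real.log a < Real.log b := Real.log_lt_log (by linarith) hab
  have hlb : 0 < Real.log b := hla.trans hlab
  have hκ : 0 ≤ 1 / Real.log a - 1 / Real.log b := by
    rw [sub_nonneg]; gcongr
  have hlog : Real.log x ≤ Real.log s := Real.log_le_log hx hxs
  refine le_trans (ENNReal.ofReal_le_ofReal (mul_le_mul_of_nonneg_left hlog hκ)) ?_
  rcases le_or_gt s 1 with h1 | h1
  · have : Real.log s ≤ 0 := Real.log_nonpos hs0.le h1
    rw [ENNReal.ofReal_of_nonpos (mul_nonpos_of_nonneg_of_nonpos hκ this)]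
    exact zero_le
  have hls : 0 < Real.log s := Real.log_pos h1
  set I := Finset.Ioc (N + ⌊Real.log s / Real.log b⌋₊) ⌊Real.log s / Real.log a⌋₊ with hI
  have hcard : (1 / Real.log a - 1 / Real.log b) * Real.log s ≤ (I.card : ℝ) + (N + 1 : ℕ) := by
    have e1 : Real.log s / Real.log a < ⌊Real.log s / Real.log a⌋₊ + 1 := Nat.lt_floor_add_one _
    have e2 : (⌊Real.log s / Real.log b⌋₊ : ℝ) ≤ Real.log s / Real.log b :=
      Nat.floor_le (by positivity)
    have e3 : ⌊Real.log s / Real.log a⌋₊ ≤ I.card + (N + ⌊Real.log s / Real.log b⌋₊) := by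
      rw [hI, Nat.card_Ioc]; omega
    have e3' : (⌊Real.log s / Real.log a⌋₊ : ℝ) ≤ I.card + (N + ⌊Real.log s / Real.log b⌋₊) := by
      exact_mod_cast e3
    have e4 : (1 / Real.log a - 1 / Real.log b) * Real.log s =
      Real.log s / Real.log a - Real.log s / Real.log b := by ring
    rw [e4]; push_cast; linarith
  refine le_trans (ENNReal.ofReal_le_ofReal hcard) ?_
  rw [ENNReal.ofReal_add (Nat.cast_nonneg _) (Nat.cast_nonneg _), ENNReal.ofReal_natCast,
    ENNReal.ofReal_natCast]
  gcongr
  calc (I.card : ENNReal) = ∑ k ∈ I, (1 : ENNReal) := by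
        rw [Finset.sum_const, nsmul_eq_mul, mul_one]
    _ = ∑ k ∈ I, if alph a N k ≤ S ∧ S < ENNReal.ofReal (b ^ k) then (1 : ENNReal) else 0 := by
      refine Finset.sum_congr rfl fun k hk => ?_
      rw [if_pos]
      rw [hI, Finset.mem_Ioc] at hk
      have k1 : N ≤ k := by omega
      have k2 : Real.log s / Real.log b < k := by
        have : ⌊Real.log s / Real.log b⌋₊ < k := by omega
        exact (Nat.floor_lt (by positivity)).1 this
      have k3 : (k : ℝ) ≤ Real.log s / Real.log a := (Nat.le_floor_iff (by positivity)).1 hk.2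
      rw [div_lt_iff₀ hlb] at k2
      rw [le_div_iff₀ hla] at k3
      rw [← Real.log_pow] at k2 k3
      have ha0 : (0 : ℝ) < a := by linarith
      have hb0 : (0 : ℝ) < b := by linarith
      constructor
      · rw [alph, if_neg (by omega), hSs]
        exact ENNReal.ofReal_le_ofReal ((Real.log_le_log_iff (by positivity) hs0).1 k3)
      · rw [hSs]
        exact (ENNReal.ofReal_lt_ofReal_iff (by positivity)).2
          ((Real.log_lt_log_iff hs0 (by positivity)).1 k2)
    _ ≤ _ := ENNReal.sum_le_tsum _


lemma lintegral_root {q : ℕ → ℝ} {μ : Measure Config} (hμ : IsGW q μ) (f : ℕ → ENNReal) :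
    ∫⁻ ω, f (ω []) ∂μ = ∑' l, f l * ENNReal.ofReal (q l) := by
  have := hμ.1
  have h := lintegral_map (μ := μ) (measurable_of_countable f) measurable_root
  rw [← h, lintegral_countable']
  refine tsum_congr fun l => ?_
  rw [Measure.map_apply measurable_root (measurableSet_singleton l), ← root_prob hμ]
  rfl

lemma term_alg (Q N2 K F C t Mn L : ENNReal) (htt : t⁻¹ * t = 1) (hQ : Q ≤ 2 * Mn)
    (hL : L ≤ K * F + C) :
    Q * N2 * L ≤ (2 * K) * t⁻¹ * (F * (t * N2) * Mn) + C * t⁻¹ * (t * N2 * Q) := by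
  calc _ ≤ Q * N2 * (K * F + C) := by gcongr
    _ = Q * (N2 * (K * F)) + C * N2 * Q := by ring
    _ ≤ (2 * Mn) * (N2 * (K * F)) + C * N2 * Q := by gcongr
    _ = (2 * K) * (t⁻¹ * t) * (F * N2 * Mn) + C * (t⁻¹ * t) * N2 * Q := by
        rw [htt]; ring
    _ = _ := by ring

lemma log_cmp {η : ℝ} (hη : 0 < η) (n : ℕ) :
    Real.log ((n + 2 : ℕ) : ℝ) ≤ Real.log (η * (n + 1) / 2) + |Real.log (η / 4)| := by
  have e1 : Real.log (η / 4 * ((n + 2 : ℕ) : ℝ)) ≤ Real.log (η * (n + 1) / 2) := by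
    apply Real.log_le_log (by positivity)
    push_cast
    have hn : (0 : ℝ) ≤ n := by positivity
    nlinarith
  rw [Real.log_mul (by positivity) (by positivity)] at e1
  have := neg_abs_le (Real.log (η / 4))
  linarith

lemma tsum_shift_top (g : ℕ → ENNReal) (h : ∑' l, g l = ⊤) (h0 : g 0 ≠ ⊤) (h1 : g 1 ≠ ⊤) :
    ∑' n, g (n + 2) = ⊤ := by
  rw [tsum_eq_zero_add' ENNReal.summable, tsum_eq_zero_add' ENNReal.summable] at h
  by_contra hne
  exact absurd h (ENNReal.add_ne_top.2 ⟨h0, ENNReal.add_ne_top.2 ⟨h1, hne⟩⟩)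

lemma diverge {q : ℕ → ℝ} (hq : ∀ l, 0 ≤ q l) (t : ENNReal) (ht0 : t ≠ 0) (htT : t ≠ ⊤)
    (ht : ∑' l : ℕ, t * (l : ENNReal) * ENNReal.ofReal (q l) ≤ 1)
    (hX : ∑' l : ℕ, ENNReal.ofReal (q l * (l : ℝ) * Real.log l) = ⊤)
    {η κ : ℝ} (hη : 0 < η) (hκ : 0 < κ) (Mn : ℕ → ENNReal)
    (hM : ∀ n, ENNReal.ofReal (q (n + 2)) ≤ 2 * Mn n) :
    ∑' n : ℕ, ENNReal.ofReal (κ * Real.log (η * (n + 1) / 2)) * (t * ((n + 2 : ℕ) : ENNReal)) * Mn n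
      = ⊤ := by
  have htt : t⁻¹ * t = 1 := ENNReal.inv_mul_cancel ht0 htT
  have hterm : ∀ n : ℕ,
      ENNReal.ofReal (q (n + 2) * ((n + 2 : ℕ) : ℝ) * Real.log ((n + 2 : ℕ) : ℝ)) ≤
      (2 * ENNReal.ofReal (1 / κ)) * t⁻¹ * (ENNReal.ofReal (κ * Real.log (η * (n + 1) / 2)) *
        (t * ((n + 2 : ℕ) : ENNReal)) * Mn n) +
      ENNReal.ofReal |Real.log (η / 4)| * t⁻¹ *
        (t * ((n + 2 : ℕ) : ENNReal) * ENNReal.ofReal (q (n + 2))) := by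
    intro n
    rw [ENNReal.ofReal_mul (mul_nonneg (hq _) (Nat.cast_nonneg _)), ENNReal.ofReal_mul (hq _),
      ENNReal.ofReal_natCast]
    refine term_alg _ _ _ _ _ _ _ _ htt (hM n) ?_
    refine (ENNReal.ofReal_le_ofReal (log_cmp hη n)).trans (ENNReal.ofReal_add_le.trans ?_)
    refine add_le_add (le_of_eq ?_) le_rfl
    rw [← ENNReal.ofReal_mul (by positivity), ← mul_assoc, one_div, inv_mul_cancel₀ hκ.ne', one_mul]
  by_contra hne
  have hshift := tsum_shift_top _ hX (by simp) (by simp)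
  have hfin : ∑' n : ℕ, t * ((n + 2 : ℕ) : ENNReal) * ENNReal.ofReal (q (n + 2)) ≤ 1 := by
    refine le_trans ?_ ht
    exact ENNReal.tsum_comp_le_tsum_of_injective (f := fun n : ℕ => n + 2)
      (fun _ _ h => by simpa using h) (fun l : ℕ => t * (l : ENNReal) * ENNReal.ofReal (q l))
  have hle := ENNReal.tsum_le_tsum hterm
  rw [hshift, ENNReal.tsum_add, ENNReal.tsum_mul_left, ENNReal.tsum_mul_left, top_le_iff] at hle
  refine absurd hle (ENNReal.add_ne_top.2 ⟨?_, ?_⟩)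
  · exact ENNReal.mul_ne_top (ENNReal.mul_ne_top (by simp [ENNReal.mul_eq_top]) (by simpa using ht0)) hne
  · exact ENNReal.mul_ne_top (ENNReal.mul_ne_top (by simp) (by simpa using ht0))
      (ne_top_of_le_ne_top (by simp) hfin)

lemma sum_pJ {q : ℕ → ℝ} (hq : ∀ l, 0 ≤ q l) {μ : Measure Config} (hμ : IsGW q μ)
    {W : Config → ENNReal}
    (hW : Measurable W) (t : ENNReal) (ht0 : t ≠ 0) (htT : t ≠ ⊤)
    (ht : ∫⁻ ω, t * (ω [] : ENNReal) ∂μ ≤ 1)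
    (hpos : ∀ᵐ ω ∂μ, W ω ≠ 0) (hSf : ∀ᵐ ω ∂μ, sib W 0 ω ≠ ⊤)
    (hX : ∑' l : ℕ, ENNReal.ofReal (q l * (l : ℝ) * Real.log l) = ⊤)
    {a b : ℝ} (ha : 1 < a) (hab : a < b) (N : ℕ) :
    ∑' k, pJ μ W t (alph a N k) (ENNReal.ofReal (b ^ k)) = ⊤ := by
  classical
  have := hμ.1
  obtain ⟨η, hη, hη4⟩ := exists_eta hW hpos
  set κ := 1 / Real.log a - 1 / Real.log b with hκdef
  have hla : 0 < Real.log a := Real.log_pos ha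
  have hlab : Real.log a < Real.log b := Real.log_lt_log (by linarith) hab
  have hκ : 0 < κ := by
    rw [hκdef, sub_pos]; gcongr
  have hs := measurable_sib hW 0
  -- step 1: counting
  set cnt : Config → ENNReal := fun ω => ∑' k, if alph a N k ≤ sib W 0 ω ∧
    sib W 0 ω < ENNReal.ofReal (b ^ k) then (1 : ENNReal) else 0 with hcnt
  have hmk : ∀ k, Measurable (fun ω => if alph a N k ≤ sib W 0 ω ∧
    sib W 0 ω < ENNReal.ofReal (b ^ k) then (1 : ENNReal) else 0) := fun k =>
    Measurable.ite ((hs measurableSet_Ici).inter (hs measurableSet_Iio))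
      measurable_const measurable_const
  have hrt := measurable_rootE.const_mul t
  have h1 : ∑' k, pJ μ W t (alph a N k) (ENNReal.ofReal (b ^ k)) =
      ∫⁻ ω, cnt ω * (t * (ω [] : ENNReal)) ∂μ := by
    refine (lintegral_tsum fun k => ((hmk k).mul hrt).aemeasurable).symm.trans ?_
    refine lintegral_congr fun ω => ?_
    simp only [hcnt, Pi.mul_apply]
    rw [ENNReal.tsum_mul_right]
  -- step 2: restrict to the good events
  let f : ℕ → ENNReal := fun n => ENNReal.ofReal (κ * Real.log (η * (n + 1) / 2))
  let G : ℕ → Set Config := fun n =>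
    {ω | ω [] = n + 2 ∧ ENNReal.ofReal (η * (n + 1) / 2) ≤ sib W 0 ω}
  have hGm : ∀ n, MeasurableSet (G n) := fun n =>
    (measurable_root (measurableSet_singleton _)).inter (hs measurableSet_Ici)
  have h2 : ∑' n, f n * (t * ((n + 2 : ℕ) : ENNReal)) * μ (G n) ≤
      (∫⁻ ω, cnt ω * (t * (ω [] : ENNReal)) ∂μ) + ((N + 1 : ℕ) : ENNReal) := by
    calc ∑' n, f n * (t * ((n + 2 : ℕ) : ENNReal)) * μ (G n)
        = ∑' n, ∫⁻ ω, (G n).indicator (fun _ => f n * (t * ((n + 2 : ℕ) : ENNReal))) ω ∂μ := by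
          refine tsum_congr fun n => ?_
          rw [lintegral_indicator_const (hGm n)]
      _ = ∫⁻ ω, ∑' n, (G n).indicator (fun _ => f n * (t * ((n + 2 : ℕ) : ENNReal))) ω ∂μ := by
          rw [lintegral_tsum fun n => (measurable_const.indicator (hGm n)).aemeasurable]
      _ ≤ ∫⁻ ω, (cnt ω * (t * (ω [] : ENNReal)) +
            ((N + 1 : ℕ) : ENNReal) * (t * (ω [] : ENNReal))) ∂μ := by
          refine lintegral_mono_ae ?_
          filter_upwards [hSf] with ω hω
          rw [tsum_eq_single (ω [] - 2)]
          · by_cases hg : ω ∈ G (ω [] - 2)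
            · rw [Set.indicator_of_mem hg, ← add_mul, ← hg.1]
              gcongr
              exact count_lower ha hab N _ hω (by positivity) hg.2
            · rw [Set.indicator_of_notMem hg]; exact zero_le
          · intro n hn
            rw [Set.indicator_of_notMem]
            intro hg
            apply hn
            have := hg.1
            omega
      _ = (∫⁻ ω, cnt ω * (t * (ω [] : ENNReal)) ∂μ) +
            ((N + 1 : ℕ) : ENNReal) * ∫⁻ ω, (t * (ω [] : ENNReal)) ∂μ := by
          rw [lintegral_add_right _ (hrt.const_mul _), lintegral_const_mul _ hrt]
      _ ≤ _ := by
          gcongr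
          calc _ ≤ ((N + 1 : ℕ) : ENNReal) * 1 := by gcongr
            _ = _ := mul_one _
  -- step 3: divergence
  have h3 : ∑' n, f n * (t * ((n + 2 : ℕ) : ENNReal)) * μ (G n) = ⊤ := by
    refine diverge hq t ht0 htT ?_ hX hη hκ (fun n => μ (G n)) ?_
    · rw [← lintegral_root hμ (fun l => t * (l : ENNReal))]; exact ht
    · intro n
      have := prob_sib_large hμ hW hη hη4 n
      rw [ENNReal.div_le_iff (by simp) (by simp)] at this
      rw [mul_comm]; exact this
  rw [h3, top_le_iff, ENNReal.add_eq_top] at h2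
  rw [h1]
  exact h2.resolve_right (by simp)

lemma Del_le {b m : ℝ} (hb : 0 < b) (hbm : b < m) (n : ℕ) : ∀ s : ℕ,
    Del (ENNReal.ofReal m)⁻¹ n (fun k => ENNReal.ofReal (b ^ (k + s))) ≤
      ENNReal.ofReal (b ^ s / (m - b)) := by
  have hmb : 0 < m - b := by linarith
  have hm : 0 < m := by linarith
  induction n with
  | zero => intro s; simp [Del]
  | succ n ih =>
    intro s
    simp only [Del]
    have h := ih (s + 1)
    simp only [show ∀ k, k + (s + 1) = k + 1 + s by intro k; ring] at h
    calc _ ≤ (ENNReal.ofReal m)⁻¹ * (ENNReal.ofReal (b ^ (0 + s)) +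
          ENNReal.ofReal (b ^ (s + 1) / (m - b))) := by gcongr
      _ = _ := by
        rw [← ENNReal.ofReal_add (by positivity) (by positivity), ← ENNReal.ofReal_inv_of_pos hm,
          ← ENNReal.ofReal_mul (by positivity)]
        congr 1
        field_simp
        ring


/-! ### Pointwise part -/

def WW (c : ℕ → ℝ) (ω : Config) : ENNReal :=
  liminf (fun k => ENNReal.ofReal ((Z ω [] k : ℝ) / c k)) atTop

lemma measurable_WW (c : ℕ → ℝ) : Measurable (WW c) := by
  unfold WW
  refine Measurable.liminf fun k => ?_
  exact (((measurable_of_countable (fun n : ℕ => (n : ℝ))).comp (measurable_Z k)).div_const _).ennreal_ofReal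

lemma WW_shv {c : ℕ → ℝ} {ω : Config} {u : List ℕ} (hu : memTree ω u) {w : ℝ}
    (h : Tendsto (fun k => (Z ω u k : ℝ) / c k) atTop (nhds w)) :
    WW c (shv u ω) = ENNReal.ofReal w := by
  unfold WW
  simp only [← Z_shv ω u hu]
  exact (ENNReal.tendsto_ofReal h).liminf_eq

lemma winf_add {c : ℕ → ℝ} (hc : ∀ n, 0 < c n) {m : ℝ} (hm : 1 < m)
    (hcr : Tendsto (fun n => c (n + 1) / c n) atTop (nhds m)) {ω : Config} {w : List ℕ → ℝ}
    (hw : ∀ u, memTree ω u → Tendsto (fun k => (Z ω u k : ℝ) / c k) atTop (nhds (w u)) ∧ 0 < w u)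
    {u : List ℕ} (hu : memTree ω u) :
    ∑ i ∈ Finset.range (ω u), w (u ++ [i]) = m * w u := by
  have h1 : Tendsto (fun k => (Z ω u (k + 1) : ℝ) / c k) atTop (nhds (m * w u)) := by
    have := hcr.mul ((tendsto_add_atTop_iff_nat 1).2 (hw u hu).1)
    refine this.congr fun k => ?_
    have e1 := (hc k).ne'
    have e2 := (hc (k + 1)).ne'
    field_simp
  have h2 : Tendsto (fun k => (Z ω u (k + 1) : ℝ) / c k) atTop
      (nhds (∑ i ∈ Finset.range (ω u), w (u ++ [i]))) := by
    have : (fun k => (Z ω u (k + 1) : ℝ) / c k) =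
        fun k => ∑ i ∈ Finset.range (ω u), (Z ω (u ++ [i]) k : ℝ) / c k := by
      funext k
      rw [Z_succ_vertex ω u hu k, Nat.cast_sum, Finset.sum_div]
    rw [this]
    refine tendsto_finsetSum _ fun i hi => (hw _ ?_).1
    exact (memTree_snoc ω u i).2 ⟨hu, Finset.mem_range.1 hi⟩
  exact tendsto_nhds_unique h2 h1

/-- Deterministic properties of a good tree. -/
structure Good (m : ℝ) (W : Config → ENNReal) (ω : Config) (w : List ℕ → ℝ) : Prop where
  pos : ∀ u, memTree ω u → 0 < w u
  eqW : ∀ u, memTree ω u → W (shv u ω) = ENNReal.ofReal (w u)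
  add : ∀ u, memTree ω u → ∑ i ∈ Finset.range (ω u), w (u ++ [i]) = m * w u

lemma shv_nil (ω : Config) : shv [] ω = ω := rfl

lemma shv_root (ω : Config) (u : List ℕ) : shv u ω [] = ω u := by simp [shv]

lemma tsum_range_ite (k : ℕ) (P : ℕ → Prop) [DecidablePred P] (f : ℕ → ENNReal) :
    ∑' i, (if i < k ∧ P i then f i else 0) = ∑ i ∈ Finset.range k, if P i then f i else 0 := by
  rw [tsum_eq_sum (s := Finset.range k)]
  · refine Finset.sum_congr rfl fun i hi => ?_
    have := Finset.mem_range.1 hi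
    simp [this]
  · intro i hi
    rw [if_neg]
    intro h
    exact hi (Finset.mem_range.2 h.1)

lemma Good.sumW {m : ℝ} (hm : 1 < m) {W : Config → ENNReal} {ω : Config} {w : List ℕ → ℝ}
    (g : Good m W ω w) {u : List ℕ} (hu : memTree ω u) :
    ∑ i ∈ Finset.range (ω u), W (shv (u ++ [i]) ω) = ENNReal.ofReal m * W (shv u ω) := by
  have hc : ∀ i ∈ Finset.range (ω u), memTree ω (u ++ [i]) := fun i hi =>
    (memTree_snoc ω u i).2 ⟨hu, Finset.mem_range.1 hi⟩
  rw [Finset.sum_congr rfl fun i hi => g.eqW _ (hc i hi), g.eqW u hu,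
    ← ENNReal.ofReal_sum_of_nonneg fun i hi => (g.pos _ (hc i hi)).le, g.add u hu,
    ENNReal.ofReal_mul (by linarith)]

lemma Good.sib_add {m : ℝ} (hm : 1 < m) {W : Config → ENNReal} {ω : Config} {w : List ℕ → ℝ}
    (g : Good m W ω w) {u : List ℕ} (hu : memTree ω u) {i : ℕ} (hi : i < ω u) :
    W (shv (u ++ [i]) ω) + sib W i (shv u ω) = ENNReal.ofReal m * W (shv u ω) := by
  classical
  rw [← g.sumW hm hu, ← Finset.add_sum_erase _ _ (Finset.mem_range.2 hi)]
  congr 1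
  have : sib W i (shv u ω) = ∑' j, if j < ω u ∧ j ≠ i then W (shv (u ++ [j]) ω) else 0 := by
    unfold sib
    refine tsum_congr fun j => ?_
    rw [shv_root, sh_shv]
  rw [this, tsum_range_ite, ← Finset.sum_filter]
  congr 1
  ext j; simp [and_comm]

lemma Good.sib_le {m : ℝ} (hm : 1 < m) {W : Config → ENNReal} {ω : Config} {w : List ℕ → ℝ}
    (g : Good m W ω w) {u : List ℕ} (hu : memTree ω u) (i : ℕ) :
    sib W i (shv u ω) ≤ ENNReal.ofReal (m * w u) := by
  classical
  rw [ENNReal.ofReal_mul (by linarith), ← g.eqW u hu, ← g.sumW hm hu]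
  have : sib W i (shv u ω) = ∑' j, if j < ω u ∧ j ≠ i then W (shv (u ++ [j]) ω) else 0 := by
    unfold sib
    refine tsum_congr fun j => ?_
    rw [shv_root, sh_shv]
  rw [this, tsum_range_ite]
  refine Finset.sum_le_sum fun j _ => ?_
  split_ifs
  · exact le_rfl
  · exact zero_le

lemma rayVertex_zero (r : ℕ → ℕ) : rayVertex r 0 = [] := by simp [rayVertex]

lemma rayVertex_succ (r : ℕ → ℕ) (n : ℕ) : rayVertex r (n + 1) = rayVertex r n ++ [r n] := by
  unfold rayVertex
  rw [List.ofFn_succ', List.concat_eq_append]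
  simp

lemma length_rayVertex (r : ℕ → ℕ) (n : ℕ) : (rayVertex r n).length = n := by simp [rayVertex]

lemma measurableSet_ray (n : ℕ) (u : List ℕ) : MeasurableSet {r : ℕ → ℕ | rayVertex r n = u} := by
  have h : Measurable (fun (r : ℕ → ℕ) (i : Fin n) => r i) := by fun_prop
  exact h ((Set.to_countable {f : Fin n → ℕ | List.ofFn f = u}).measurableSet)

lemma ray_snoc (r : ℕ → ℕ) (v : List ℕ) (i : ℕ) :
    rayVertex r (v ++ [i]).length = v ++ [i] ↔ rayVertex r v.length = v ∧ r v.length = i := by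
  rw [List.length_append, List.length_singleton, rayVertex_succ]
  constructor
  · intro h
    have := List.append_inj h (length_rayVertex r _)
    exact ⟨this.1, by simpa using this.2⟩
  · rintro ⟨h1, h2⟩; rw [h1, h2]

section unif
variable {m : ℝ} {W : Config → ENNReal} {ω : Config} {w : List ℕ → ℝ} {U : Measure (ℕ → ℕ)}

lemma null_exit (hm : 1 < m) (g : Good m W ω w) [IsProbabilityMeasure U]
    (hU : ∀ u, memTree ω u → U {r | rayVertex r u.length = u} =
      ENNReal.ofReal ((m ^ u.length)⁻¹ * w u / w [])) {v : List ℕ} (hv : memTree ω v) :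
    U {r | rayVertex r v.length = v ∧ ¬ r v.length < ω v} = 0 := by
  have hE : MeasurableSet {r : ℕ → ℕ | r v.length < ω v} :=
    (measurable_pi_apply v.length) measurableSet_Iio
  have h := measure_inter_add_sdiff (μ := U) {r | rayVertex r v.length = v} hE
  have e1 : {r : ℕ → ℕ | rayVertex r v.length = v} ∩ {r | r v.length < ω v} =
      ⋃ i ∈ Finset.range (ω v), {r | rayVertex r (v ++ [i]).length = v ++ [i]} := by
    ext r
    simp only [ray_snoc, mem_inter_iff, mem_ofPred_eq, mem_iUnion, Finset.mem_range, exists_prop]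
    constructor
    · rintro ⟨h1, h2⟩; exact ⟨_, h2, h1, rfl⟩
    · rintro ⟨i, h1, h2, rfl⟩; exact ⟨h2, h1⟩
  have hm0 : 0 < m := by linarith
  have hw0 := g.pos [] (memTree_nil ω)
  have e2 : U ({r : ℕ → ℕ | rayVertex r v.length = v} ∩ {r | r v.length < ω v}) =
      U {r | rayVertex r v.length = v} := by
    rw [e1, measure_biUnion_finset _ fun i _ => measurableSet_ray _ _]
    · have hc : ∀ i ∈ Finset.range (ω v), memTree ω (v ++ [i]) := fun i hi =>
        (memTree_snoc ω v i).2 ⟨hv, Finset.mem_range.1 hi⟩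
      rw [Finset.sum_congr rfl fun i hi => hU _ (hc i hi), hU v hv,
        ← ENNReal.ofReal_sum_of_nonneg]
      · congr 1
        simp only [List.length_append, List.length_singleton]
        rw [← Finset.sum_div, ← Finset.mul_sum, g.add v hv]
        field_simp
        ring
      · intro i hi
        have := g.pos _ (hc i hi)
        positivity
    · intro i _ j _ hij
      refine Set.disjoint_left.2 fun r h1 h2 => hij ?_
      simp only [mem_ofPred_eq, ray_snoc] at h1 h2
      rw [← h1.2, h2.2]
  rw [e2] at h
  have h3 : U ({r : ℕ → ℕ | rayVertex r v.length = v} \ {r | r v.length < ω v}) = 0 := by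
    have : U {r | rayVertex r v.length = v} + U ({r : ℕ → ℕ | rayVertex r v.length = v} \ {r | r v.length < ω v})
      = U {r | rayVertex r v.length = v} + 0 := by rw [h, add_zero]
    exact (ENNReal.add_right_inj (measure_ne_top U _)).1 this
  exact h3

lemma ray_mem (hm : 1 < m) (g : Good m W ω w) [IsProbabilityMeasure U]
    (hU : ∀ u, memTree ω u → U {r | rayVertex r u.length = u} =
      ENNReal.ofReal ((m ^ u.length)⁻¹ * w u / w [])) :
    ∀ᵐ r ∂U, ∀ n, memTree ω (rayVertex r n) := by
  have h : ∀ᵐ r ∂U, ∀ v : List ℕ, memTree ω v → rayVertex r v.length = v → r v.length < ω v := by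
    rw [ae_all_iff]
    intro v
    by_cases hv : memTree ω v
    · rw [ae_iff]
      have := null_exit hm g hU hv
      simpa [hv] using this
    · simp [hv]
  filter_upwards [h] with r hr n
  induction n with
  | zero => rw [rayVertex_zero]; exact memTree_nil ω
  | succ n ih =>
    rw [rayVertex_succ]
    have := hr _ ih (by rw [length_rayVertex])
    rw [length_rayVertex] at this
    exact (memTree_snoc _ _ _).2 ⟨ih, this⟩

lemma claim1 (hm : 1 < m) (g : Good m W ω w) [IsProbabilityMeasure U]
    (hU : ∀ u, memTree ω u → U {r | rayVertex r u.length = u} =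
      ENNReal.ofReal ((m ^ u.length)⁻¹ * w u / w [])) (n : ℕ) :
    ∀ (A : ℕ → Set ENNReal) (v : List ℕ), memTree ω v →
      U {r | rayVertex r v.length = v ∧
        ∀ k < n, sib W (r (v.length + k)) (shv (rayVertex r (v.length + k)) ω) ∈ A k} * W ω ≤
      ((ENNReal.ofReal m)⁻¹) ^ v.length * PP W (ENNReal.ofReal m)⁻¹ n A (shv v ω) := by
  classical
  have hm0 : 0 < m := by linarith
  have hw0 := g.pos [] (memTree_nil ω)
  have hW0 : W ω = ENNReal.ofReal (w []) := g.eqW [] (memTree_nil ω)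
  induction n with
  | zero =>
    intro A v hv
    have hwv := g.pos v hv
    simp only [not_lt_zero, IsEmpty.forall_iff, implies_true, and_true, PP]
    rw [hU v hv, hW0, g.eqW v hv, ← ENNReal.ofReal_mul (by positivity),
      ← ENNReal.ofReal_inv_of_pos hm0, ← ENNReal.ofReal_pow (by positivity),
      ← ENNReal.ofReal_mul (by positivity)]
    apply le_of_eq
    congr 1
    rw [inv_pow]
    field_simp
  | succ n ih =>
    intro A v hv
    set t := (ENNReal.ofReal m)⁻¹
    let E : ℕ → Set (ℕ → ℕ) := fun i => {r | rayVertex r (v ++ [i]).length = v ++ [i] ∧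
        ∀ k < n, sib W (r ((v ++ [i]).length + k)) (shv (rayVertex r ((v ++ [i]).length + k)) ω) ∈
          A (k + 1)}
    have hsub : {r | rayVertex r v.length = v ∧
        ∀ k < n + 1, sib W (r (v.length + k)) (shv (rayVertex r (v.length + k)) ω) ∈ A k} ⊆
        {r | rayVertex r v.length = v ∧ ¬ r v.length < ω v} ∪
        ⋃ i ∈ (Finset.range (ω v)).filter (fun i => sib W i (shv v ω) ∈ A 0), E i := by
      rintro r ⟨h1, h2⟩
      by_cases h : r v.length < ω v
      · right
        simp only [mem_iUnion, Finset.mem_filter, Finset.mem_range, exists_prop]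
        refine ⟨r v.length, ⟨h, ?_⟩, (ray_snoc _ _ _).2 ⟨h1, rfl⟩, ?_⟩
        · have := h2 0 (by omega)
          rwa [add_zero, h1] at this
        · intro k hk
          have := h2 (k + 1) (by omega)
          rw [List.length_append, List.length_singleton, add_assoc, add_comm 1 k]
          exact this
      · left; exact ⟨h1, h⟩
    have hle : U {r | rayVertex r v.length = v ∧
        ∀ k < n + 1, sib W (r (v.length + k)) (shv (rayVertex r (v.length + k)) ω) ∈ A k} ≤
        ∑ i ∈ (Finset.range (ω v)).filter (fun i => sib W i (shv v ω) ∈ A 0), U (E i) := by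
      refine (measure_mono hsub).trans ((measure_union_le _ _).trans ?_)
      rw [null_exit hm g hU hv, zero_add]
      exact measure_biUnion_finset_le _ _
    refine (mul_le_mul_left hle _).trans ?_
    rw [Finset.sum_mul]
    have hPP : PP W t (n + 1) A (shv v ω) = ∑ i ∈ (Finset.range (ω v)).filter
        (fun i => sib W i (shv v ω) ∈ A 0), t * PP W t n (fun k => A (k + 1)) (shv (v ++ [i]) ω) := by
      rw [Finset.sum_filter, ← tsum_range_ite]
      simp only [PP]
      refine tsum_congr fun i => ?_
      rw [shv_root, sh_shv]
    rw [hPP, Finset.mul_sum]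
    refine Finset.sum_le_sum fun i hi => ?_
    rw [Finset.mem_filter, Finset.mem_range] at hi
    have := ih (fun k => A (k + 1)) (v ++ [i]) ((memTree_snoc ω v i).2 ⟨hv, hi.1⟩)
    refine this.trans (le_of_eq ?_)
    rw [List.length_append, List.length_singleton, pow_succ, mul_assoc]

lemma claim2 (hm : 1 < m) (g : Good m W ω w) [IsProbabilityMeasure U]
    (hU : ∀ u, memTree ω u → U {r | rayVertex r u.length = u} =
      ENNReal.ofReal ((m ^ u.length)⁻¹ * w u / w []))
    (α : ℕ → ENNReal)
    (h0 : ⨅ n, PP W (ENNReal.ofReal m)⁻¹ n (fun k => Set.Iio (α k)) ω = 0) :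
    ∀ᵐ r ∂U, ∃ k, α k ≤ sib W (r k) (shv (rayVertex r k) ω) := by
  rw [ae_iff]
  have hW0 : W ω = ENNReal.ofReal (w []) := g.eqW [] (memTree_nil ω)
  have hw0 := g.pos [] (memTree_nil ω)
  have : U {r | ¬ ∃ k, α k ≤ sib W (r k) (shv (rayVertex r k) ω)} * W ω ≤ 0 := by
    rw [← h0]
    refine le_iInf fun n => ?_
    have := claim1 hm g hU n (fun k => Set.Iio (α k)) [] (memTree_nil ω)
    simp only [List.length_nil, pow_zero, one_mul, shv_nil] at this
    refine le_trans (mul_le_mul_left (measure_mono ?_) _) this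
    intro r hr
    refine ⟨rayVertex_zero r, fun k _ => ?_⟩
    rw [zero_add]
    by_contra hc
    exact hr ⟨k, not_lt.1 hc⟩
  rw [nonpos_iff_eq_zero, mul_eq_zero] at this
  refine this.resolve_right ?_
  rw [hW0]
  simpa using hw0

end unif


lemma holder_lim {m w0 : ℝ} (hm : 1 < m) (hw0 : 0 < w0) (x : ℕ → ℝ) (hx0 : ∀ n, 0 ≤ x n)
    (hx1 : ∀ n, x n ≤ 1) (a : ℕ → ℝ) (ha : ∀ j, 1 < a j) (hat : Tendsto a atTop (nhds m))
    (hf : ∀ j, ∃ᶠ n in atTop, (a j) ^ n / (m ^ (n + 1) * w0) ≤ x n) :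
    liminf (fun n : ℕ => (-1 / (n : ℝ)) * Real.log (x n)) atTop = 0 := by
  have hm0 : 0 < m := by linarith
  have hpos : ∀ n : ℕ, 0 ≤ (-1 / (n : ℝ)) * Real.log (x n) := fun n =>
    mul_nonneg_of_nonpos_of_nonpos
      (div_nonpos_of_nonpos_of_nonneg (by norm_num) (Nat.cast_nonneg n))
      (Real.log_nonpos (hx0 n) (hx1 n))
  have hup : ∀ δ > 0, ∃ᶠ n : ℕ in atTop, (-1 / (n : ℝ)) * Real.log (x n) ≤ δ := by
    intro δ hδ
    have hlog : Tendsto (fun j => Real.log (a j)) atTop (nhds (Real.log m)) :=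
      (Real.continuousAt_log hm0.ne').tendsto.comp hat
    obtain ⟨j, hj⟩ := (hlog.eventually (lt_mem_nhds (show Real.log m - δ / 2 < Real.log m by linarith))).exists
    have hC : Tendsto (fun n : ℕ => (Real.log m + Real.log w0) / (n : ℝ)) atTop (nhds 0) :=
      tendsto_const_div_atTop_nhds_zero_nat _
    have hev := hC.eventually (gt_mem_nhds (show (0 : ℝ) < δ / 2 by linarith))
    refine ((hf j).and_eventually (hev.and (eventually_ge_atTop 1))).mono ?_
    rintro n ⟨h1, h2, h3⟩
    have hn : (0 : ℝ) < n := by exact_mod_cast h3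
    have haj : 0 < a j := by linarith [ha j]
    have hl := Real.log_le_log (by positivity) h1
    rw [Real.log_div (by positivity) (by positivity), Real.log_mul (by positivity) hw0.ne',
      Real.log_pow, Real.log_pow] at hl
    push_cast at hl
    have e : (-1 / (n : ℝ)) * Real.log (x n) = (- Real.log (x n)) / n := by ring
    rw [div_lt_iff₀ hn] at h2
    rw [e, div_le_iff₀ hn]
    have h4 : (Real.log m - Real.log (a j)) * n ≤ δ / 2 * n := by
      apply mul_le_mul_of_nonneg_right _ hn.le
      linarith
    linarith
  have hbd : IsBoundedUnder (· ≥ ·) atTop (fun n : ℕ => (-1 / (n : ℝ)) * Real.log (x n)) :=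
    isBoundedUnder_of ⟨0, hpos⟩
  apply le_antisymm
  · refine le_of_forall_pos_le_add fun δ hδ => ?_
    rw [zero_add]
    exact liminf_le_of_frequently_le (hup δ hδ) hbd
  · exact le_liminf_of_le (IsCoboundedUnder.of_frequently_le (hup 1 one_pos))
      (Eventually.of_forall hpos)

lemma mean_enn {q : ℕ → ℝ} (hq : ∀ l, 0 ≤ q l) {m : ℝ} (hm : m = ∑' l : ℕ, (l : ℝ) * q l)
    (hm1 : 1 < m) {μ : Measure Config} (hμ : IsGW q μ) :
    ∫⁻ ω, (ENNReal.ofReal m)⁻¹ * (ω [] : ENNReal) ∂μ ≤ 1 := by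
  have hs : Summable (fun l : ℕ => (l : ℝ) * q l) := by
    by_contra h
    rw [tsum_eq_zero_of_not_summable h] at hm
    linarith
  have h := ENNReal.ofReal_tsum_of_nonneg (fun l : ℕ => mul_nonneg (Nat.cast_nonneg l) (hq l)) hs
  rw [← hm] at h
  rw [lintegral_const_mul _ measurable_rootE, lintegral_root hμ (fun l => (l : ENNReal))]
  have e : ∑' l : ℕ, (l : ENNReal) * ENNReal.ofReal (q l) = ENNReal.ofReal m := by
    rw [h]
    refine tsum_congr fun l => ?_
    rw [ENNReal.ofReal_mul (Nat.cast_nonneg l), ENNReal.ofReal_natCast]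
  rw [e, ENNReal.inv_mul_cancel (by simp; linarith) (by simp)]

lemma freq_ray {m : ℝ} {W : Config → ENNReal} {ω : Config} {w : List ℕ → ℝ}
    (hm : 1 < m) (g : Good m W ω w) {a : ℝ} (ha : 1 < a) (r : ℕ → ℕ)
    (hr : ∀ n, memTree ω (rayVertex r n))
    (h : ∀ N, ∃ k, alph a N k ≤ sib W (r k) (shv (rayVertex r k) ω)) :
    ∃ᶠ n in atTop, a ^ n ≤ m * w (rayVertex r n) := by
  rw [frequently_atTop]
  intro N
  obtain ⟨k, hk⟩ := h N
  have hle := hk.trans (g.sib_le hm (hr k) (r k))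
  unfold alph at hle
  split_ifs at hle with hkN
  · exact absurd (top_le_iff.1 hle) ENNReal.ofReal_ne_top
  · have hw := g.pos _ (hr k)
    exact ⟨k, not_lt.1 hkN, (ENNReal.ofReal_le_ofReal_iff (by positivity)).1 hle⟩


/-- Let `𝒯` be a Galton–Watson tree with offspring law `q` (`q 0 = 0`, mean `m ∈ (1,∞)`),
`c n` Seneta–Heyde constants, `W∞(u) = lim_k Z_k(u)/c_k` and `UNIF` the uniform measure on
the boundary, characterized by `UNIF({r : r_n = u}) = m^{-n} W∞(u) / W∞(e)`. If
`E[ν ln ν] = ∞`, then for `GW`-a.e. tree, for `UNIF`-a.e. ray `r`, the Hölder exponent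
`Hö(UNIF)(r) = liminf_n (-1/n) ln UNIF({r' : r'_n = r_n})` equals `0`. -/
theorem holder_exponent_of_unif_eq_zero
    (q : ℕ → ℝ) (hq_nonneg : ∀ ℓ, 0 ≤ q ℓ) (hq_zero : q 0 = 0) (hq_sum : ∑' ℓ, q ℓ = 1)
    (m : ℝ) (hm_def : m = ∑' ℓ : ℕ, (ℓ : ℝ) * q ℓ) (hm_one : 1 < m)
    (GW : Measure Config) (hGW : IsGW q GW)
    (c : ℕ → ℝ) (hc_pos : ∀ n, 0 < c n)
    (hc_ratio : Filter.Tendsto (fun n => c (n + 1) / c n) Filter.atTop (nhds m))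
    (Winf : Config → List ℕ → ℝ)
    (hWinf : ∀ᵐ ω ∂GW, ∀ u : List ℕ, memTree ω u →
      Filter.Tendsto (fun k => (Z ω u k : ℝ) / c k) Filter.atTop (nhds (Winf ω u)) ∧
        0 < Winf ω u)
    (UNIF : Config → Measure (ℕ → ℕ))
    (hUNIF_prob : ∀ᵐ ω ∂GW, IsProbabilityMeasure (UNIF ω))
    (hUNIF : ∀ᵐ ω ∂GW, ∀ u : List ℕ, memTree ω u →
      UNIF ω {r | rayVertex r u.length = u}
        = ENNReal.ofReal ((m ^ u.length)⁻¹ * Winf ω u / Winf ω []))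
    (hXlogX : ∑' ℓ : ℕ, ENNReal.ofReal (q ℓ * (ℓ : ℝ) * Real.log ℓ) = ⊤) :
    ∀ᵐ ω ∂GW, ∀ᵐ r ∂(UNIF ω),
      Filter.liminf
        (fun n : ℕ => (-1 / (n : ℝ)) *
          Real.log ((UNIF ω {r' | rayVertex r' n = rayVertex r n}).toReal))
        Filter.atTop = 0 := by
  have hprob := hGW.1
  have hm0 : 0 < m := by linarith
  have hmne : ENNReal.ofReal m ≠ 0 := by simpa using hm0
  have ht0 : (ENNReal.ofReal m)⁻¹ ≠ 0 := by simp
  have htT : (ENNReal.ofReal m)⁻¹ ≠ ⊤ := by simpa using hm0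
  have hgood : ∀ᵐ ω ∂GW, Good m (WW c) ω (Winf ω) := by
    filter_upwards [hWinf] with ω h
    exact ⟨fun u hu => (h u hu).2, fun u hu => WW_shv hu (h u hu).1,
      fun u hu => winf_add hc_pos hm_one hc_ratio h hu⟩
  have ht := mean_enn hq_nonneg hm_def hm_one hGW
  have hinv : (ENNReal.ofReal m)⁻¹ * ENNReal.ofReal m = 1 :=
    ENNReal.inv_mul_cancel hmne (by simp)
  have hWt : ∀ᵐ ω ∂GW, ∀ i < ω [], WW c ω =
      (ENNReal.ofReal m)⁻¹ * (WW c (sh i ω) + sib (WW c) i ω) := by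
    filter_upwards [hgood] with ω g i hi
    have := g.sib_add hm_one (memTree_nil ω) hi
    rw [← sh_shv, shv_nil] at this
    rw [this, ← mul_assoc, hinv, one_mul]
  have hWs : ∀ᵐ ω ∂GW, WW c ω =
      ∑' i, if i < ω [] then (ENNReal.ofReal m)⁻¹ * WW c (sh i ω) else 0 := by
    filter_upwards [hgood] with ω g
    have h1 := tsum_range_ite (ω []) (fun _ => True)
      (fun i => (ENNReal.ofReal m)⁻¹ * WW c (sh i ω))
    simp only [and_true, if_true] at h1
    rw [h1, ← Finset.mul_sum]
    have := g.sumW hm_one (memTree_nil ω)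
    simp only [← sh_shv, shv_nil] at this
    rw [this, ← mul_assoc, hinv, one_mul]
  have hWf : ∀ᵐ ω ∂GW, WW c ω ≠ ⊤ := by
    filter_upwards [hgood] with ω g
    have := g.eqW [] (memTree_nil ω)
    rw [shv_nil] at this
    rw [this]; exact ENNReal.ofReal_ne_top
  have hpos : ∀ᵐ ω ∂GW, WW c ω ≠ 0 := by
    filter_upwards [hgood] with ω g
    have := g.eqW [] (memTree_nil ω)
    rw [shv_nil] at this
    rw [this]; simpa using g.pos [] (memTree_nil ω)
  have hSf : ∀ᵐ ω ∂GW, sib (WW c) 0 ω ≠ ⊤ := by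
    filter_upwards [hgood] with ω g
    have := g.sib_le hm_one (memTree_nil ω) 0
    rw [shv_nil] at this
    exact ne_top_of_le_ne_top ENNReal.ofReal_ne_top this
  let a : ℕ → ℝ := fun j => m - (m - 1) / ((j : ℝ) + 2)
  have ha1 : ∀ j, 1 < a j := by
    intro j
    have : (m - 1) / ((j : ℝ) + 2) < m - 1 := by
      apply div_lt_self (by linarith)
      have : (0 : ℝ) ≤ j := Nat.cast_nonneg j
      linarith
    change 1 < m - (m - 1) / ((j : ℝ) + 2)
    linarith
  have ham : ∀ j, a j < m := by
    intro j
    have : 0 < (m - 1) / ((j : ℝ) + 2) := div_pos (by linarith) (by positivity)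
    change m - (m - 1) / ((j : ℝ) + 2) < m
    linarith
  have hat : Tendsto a atTop (nhds m) := by
    have h : Tendsto (fun j : ℕ => (m - 1) / (((j + 2 : ℕ) : ℕ) : ℝ)) atTop (nhds 0) :=
      (tendsto_add_atTop_iff_nat 2).2 (tendsto_const_div_atTop_nhds_zero_nat (m - 1))
    have h2 := h.const_sub m
    rw [sub_zero] at h2
    refine h2.congr fun j => ?_
    push_cast
    rfl
  have hPP : ∀ᵐ ω ∂GW, ∀ j N : ℕ, ⨅ n, PP (WW c) (ENNReal.ofReal m)⁻¹ n
      (fun k => Set.Iio (alph (a j) N k)) ω = 0 := by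
    rw [ae_all_iff]
    intro j
    rw [ae_all_iff]
    intro N
    have hab : a j < (a j + m) / 2 := by linarith [ham j]
    have hbm : (a j + m) / 2 < m := by linarith [ham j]
    refine PP_zero hGW (measurable_WW c) _ ht hWt hWs hWf (alph (a j) N)
      (fun k => ENNReal.ofReal (((a j + m) / 2) ^ k))
      (ENNReal.ofReal (((a j + m) / 2) ^ 0 / (m - (a j + m) / 2))) ENNReal.ofReal_ne_top
      (fun n => ?_) ?_
    · exact Del_le (by linarith [ha1 j]) hbm n 0
    · exact sum_pJ hq_nonneg hGW (measurable_WW c) _ ht0 htT ht hpos hSf hXlogX (ha1 j) hab N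
  filter_upwards [hgood, hUNIF_prob, hUNIF, hPP] with ω g hUp hU hP
  have hall : ∀ᵐ r ∂(UNIF ω), ∀ j N : ℕ, ∃ k,
      alph (a j) N k ≤ sib (WW c) (r k) (shv (rayVertex r k) ω) := by
    rw [ae_all_iff]
    intro j
    rw [ae_all_iff]
    intro N
    exact claim2 hm_one g hU _ (hP j N)
  filter_upwards [hall, ray_mem hm_one g hU] with r hr hmem
  have hw0 := g.pos [] (memTree_nil ω)
  refine holder_lim hm_one hw0 _ (fun n => ENNReal.toReal_nonneg)
    (fun n => ENNReal.toReal_le_of_le_ofReal zero_le_one (by simpa using prob_le_one)) a ha1 hat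
    fun j => (freq_ray hm_one g (ha1 j) r hmem (hr j)).mono fun n hn => ?_
  have hUn := hU _ (hmem n)
  rw [length_rayVertex] at hUn
  have hwn := g.pos _ (hmem n)
  rw [hUn, ENNReal.toReal_ofReal (by positivity)]
  rw [div_le_div_iff₀ (by positivity) hw0]
  have e : (m ^ n)⁻¹ * Winf ω (rayVertex r n) * (m ^ (n + 1) * Winf ω []) =
      m * Winf ω (rayVertex r n) * Winf ω [] := by
    rw [pow_succ]
    field_simp
  rw [e]
  exact mul_le_mul_of_nonneg_right hn hw0.le

end
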